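/- Let k be a field and let t ≤ p be positive integers. Let R = k[y_{ij} : 1 ≤ i ≤ j ≤ p] be the polynomial ring with maximal homogeneous ideal 𝔪, let Y be the symmetric p×p matrix whose (i,j)-entry is y_{min(i,j),max(i,j)}, and let I = I_t(Y) be the ideal generated by the determinants of all t×t submatrices of Y. Set h = (p−t+1)(p−t+2)/2. Then for all integers m, r, c ≥ 1 one has the containment I^{(r(m+h−1)−h+c)} ⊆ 𝔪^{(r−1)(h−1)+c−1} · (I^{(m)})^r. -/

import Mathlib

/-- The `n`-th symbolic power of an ideal `I`:
`f ∈ I^{(n)}` iff for every associated prime `P` of `R/I` there is `s ∉ P` with `s*f ∈ I^n`.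
(For a prime ideal `I` this is exactly `{f | ∃ s ∉ I, s*f ∈ I^n} = Iⁿ R_I ∩ R`.) -/
def symbolicPower {R : Type*} [CommRing R] (I : Ideal R) (n : ℕ) : Ideal R where
  carrier := {f | ∀ P ∈ associatedPrimes R (R ⧸ I), ∃ s, s ∉ P ∧ s * f ∈ I ^ n}
  zero_mem' := by
    intro P hP
    exact ⟨1, fun h => hP.1.ne_top ((Ideal.eq_top_iff_one P).mpr h), by simp⟩
  add_mem' := by
    intro a b ha hb P hP
    obtain ⟨s, hs, hsa⟩ := ha P hP
    obtain ⟨t, ht, htb⟩ := hb P hP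
    refine ⟨s * t, fun h => ((hP.1.mem_or_mem h).elim hs ht), ?_⟩
    have heq : s * t * (a + b) = t * (s * a) + s * (t * b) := by ring
    rw [heq]
    exact Ideal.add_mem _ (Ideal.mul_mem_left _ _ hsa) (Ideal.mul_mem_left _ _ htb)
  smul_mem' := by
    intro r a ha P hP
    obtain ⟨s, hs, hsa⟩ := ha P hP
    refine ⟨s, hs, ?_⟩
    have heq : s * (r • a) = r * (s * a) := by rw [smul_eq_mul]; ring
    rw [heq]
    exact Ideal.mul_mem_left _ _ hsa

/-- The set of `t×t` minors of the generic symmetric `p×p` matrix `Y`, whose `(i,j)`-entry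
is the indeterminate `y_{min(i,j), max(i,j)}` indexed by pairs `i ≤ j`. -/
def genericSymMinors (k : Type*) [Field k] (p t : ℕ) :
    Set (MvPolynomial {ij : Fin p × Fin p // ij.1 ≤ ij.2} k) :=
  {f | ∃ ri ci : Fin t → Fin p,
    Function.Injective ri ∧ Function.Injective ci ∧
      f = Matrix.det (Matrix.of fun a b : Fin t =>
        MvPolynomial.X (⟨(min (ri a) (ci b), max (ri a) (ci b)), min_le_max⟩ :
          {ij : Fin p × Fin p // ij.1 ≤ ij.2}))}

/-! ### Weights of monomials -/

section Weights

open MvPolynomial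

variable {V k Γ : Type*} [CommRing k] [AddCommMonoid Γ] [PartialOrder Γ]
  [IsOrderedCancelAddMonoid Γ]

/-- Every monomial of `P` has weight at least `b`. -/
def WeightGE (l : (V →₀ ℕ) →+ Γ) (b : Γ) (P : MvPolynomial V k) : Prop :=
  ∀ m ∈ P.support, b ≤ l m

/-- The monomial `e` occurs in `P` with coefficient one, and all the other monomials of `P` have a
strictly smaller weight. -/
def IsLead (l : (V →₀ ℕ) →+ Γ) (e : V →₀ ℕ) (P : MvPolynomial V k) : Prop :=
  coeff e P = 1 ∧ ∀ m ∈ P.support, m = e ∨ l m < l e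

namespace WeightGE

variable {l : (V →₀ ℕ) →+ Γ} {b c : Γ} {P Q : MvPolynomial V k}

omit [IsOrderedCancelAddMonoid Γ] in
theorem mono (h : WeightGE l b P) (hc : c ≤ b) : WeightGE l c P :=
  fun m hm => hc.trans (h m hm)

omit [IsOrderedCancelAddMonoid Γ] in
theorem zero : WeightGE l b (0 : MvPolynomial V k) := fun m hm => by simp at hm

omit [IsOrderedCancelAddMonoid Γ] in
theorem add (hP : WeightGE l b P) (hQ : WeightGE l b Q) : WeightGE l b (P + Q) := by
  classical
  intro m hm
  rcases Finset.mem_union.1 (support_add hm) with h | h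
  exacts [hP m h, hQ m h]

omit [IsOrderedCancelAddMonoid Γ] in
theorem neg (hP : WeightGE l b P) : WeightGE l b (-P) := fun m hm =>
  hP m (by simpa using hm)

omit [IsOrderedCancelAddMonoid Γ] in
theorem sub (hP : WeightGE l b P) (hQ : WeightGE l b Q) : WeightGE l b (P - Q) := by
  rw [sub_eq_add_neg]
  exact hP.add hQ.neg

omit [IsOrderedCancelAddMonoid Γ] in
theorem sum {ι : Type*} {s : Finset ι} {f : ι → MvPolynomial V k}
    (h : ∀ i ∈ s, WeightGE l b (f i)) : WeightGE l b (∑ i ∈ s, f i) :=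
  Finset.sum_induction f (WeightGE l b) (fun _ _ => add) zero h

theorem mul (hP : WeightGE l b P) (hQ : WeightGE l c Q) : WeightGE l (b + c) (P * Q) := by
  classical
  intro m hm
  obtain ⟨x, hx, y, hy, rfl⟩ := Finset.mem_add.1 (support_mul P Q hm)
  rw [map_add]
  exact add_le_add (hP x hx) (hQ y hy)

omit [IsOrderedCancelAddMonoid Γ] in
theorem C (a : k) : WeightGE l 0 (MvPolynomial.C a) := by
  classical
  intro m hm
  rw [mem_support_iff, coeff_C] at hm
  split_ifs at hm with h
  · simp [← h]
  · simp at hm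

omit [IsOrderedCancelAddMonoid Γ] in
theorem one : WeightGE l 0 (1 : MvPolynomial V k) := by
  simpa using C (k := k) (l := l) 1

omit [IsOrderedCancelAddMonoid Γ] in
theorem X {v : V} (h : b ≤ l (Finsupp.single v 1)) :
    WeightGE l b (MvPolynomial.X v : MvPolynomial V k) := by
  classical
  intro m hm
  rw [mem_support_iff, coeff_X] at hm
  split_ifs at hm with h'
  · simpa [← h'] using h
  · simp at hm

theorem pow (hP : WeightGE l b P) (n : ℕ) : WeightGE l (n • b) (P ^ n) := by
  induction n with
  | zero => simpa using one
  | succ n ih => simpa [pow_succ, succ_nsmul] using ih.mul hP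

theorem prod {ι : Type*} {s : Finset ι} {f : ι → MvPolynomial V k} {b : ι → Γ}
    (h : ∀ i ∈ s, WeightGE l (b i) (f i)) : WeightGE l (∑ i ∈ s, b i) (∏ i ∈ s, f i) := by
  classical
  induction s using Finset.induction_on with
  | empty => simpa using one
  | insert a s ha ih =>
    rw [Finset.prod_insert ha, Finset.sum_insert ha]
    exact (h a (Finset.mem_insert_self a s)).mul
      (ih fun i hi => h i (Finset.mem_insert_of_mem hi))

theorem aeval {W : Type*} {g : W → MvPolynomial V k} (h : ∀ w, WeightGE l 0 (g w))
    (f : MvPolynomial W k) : WeightGE l 0 (MvPolynomial.aeval g f) := by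
  induction f using MvPolynomial.induction_on with
  | C a => simpa [algebraMap_eq] using C a
  | add p q hp hq => simpa using hp.add hq
  | mul_X p i hp => simpa using hp.mul (h i)

end WeightGE

namespace IsLead

variable {l : (V →₀ ℕ) →+ Γ} {e e' : V →₀ ℕ} {P Q : MvPolynomial V k}

omit [IsOrderedCancelAddMonoid Γ] in
theorem le (h : IsLead l e P) {m : V →₀ ℕ} (hm : m ∈ P.support) : l m ≤ l e := by
  rcases h.2 m hm with rfl | h
  exacts [le_rfl, h.le]

omit [IsOrderedCancelAddMonoid Γ] in
theorem one : IsLead l 0 (1 : MvPolynomial V k) := by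
  classical
  refine ⟨by simp, fun m hm => Or.inl ?_⟩
  by_contra h
  rw [mem_support_iff, coeff_one, if_neg (Ne.symm h)] at hm
  exact hm rfl

theorem mul (hP : IsLead l e P) (hQ : IsLead l e' Q) : IsLead l (e + e') (P * Q) := by
  classical
  have key : ∀ x ∈ P.support, ∀ y ∈ Q.support, (x = e ∧ y = e') ∨ l (x + y) < l (e + e') := by
    intro x hx y hy
    rcases hP.2 x hx with rfl | h1
    · rcases hQ.2 y hy with rfl | h2
      · exact Or.inl ⟨rfl, rfl⟩
      · right
        rw [map_add, map_add]
        exact add_lt_add_right h2 _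
    · right
      rw [map_add, map_add]
      exact add_lt_add_of_lt_of_le h1 (hQ.le hy)
  constructor
  · rw [coeff_mul, Finset.sum_eq_single (e, e')]
    · simp [hP.1, hQ.1]
    · rintro ⟨x, y⟩ hxy hne
      rw [Finset.HasAntidiagonal.mem_antidiagonal] at hxy
      by_contra h
      rcases key x (by rw [mem_support_iff]; exact left_ne_zero_of_mul h) y
        (by rw [mem_support_iff]; exact right_ne_zero_of_mul h) with h' | h'
      · exact hne (Prod.ext h'.1 h'.2)
      · simp only at hxy
        rw [hxy] at h'
        exact lt_irrefl _ h'
    · simp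
  · intro m hm
    obtain ⟨x, hx, y, hy, rfl⟩ := Finset.mem_add.1 (support_mul P Q hm)
    rcases key x hx y hy with h | h
    · left; rw [h.1, h.2]
    · exact Or.inr h

theorem pow (hP : IsLead l e P) (n : ℕ) : IsLead l (n • e) (P ^ n) := by
  induction n with
  | zero => simpa using one
  | succ n ih => simpa [pow_succ, succ_nsmul] using ih.mul hP

theorem prod {ι : Type*} {s : Finset ι} {f : ι → MvPolynomial V k} {b : ι → V →₀ ℕ}
    (h : ∀ i ∈ s, IsLead l (b i) (f i)) : IsLead l (∑ i ∈ s, b i) (∏ i ∈ s, f i) := by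
  classical
  induction s using Finset.induction_on with
  | empty => simpa using one
  | insert a s ha ih =>
    rw [Finset.prod_insert ha, Finset.sum_insert ha]
    exact (h a (Finset.mem_insert_self a s)).mul
      (ih fun i hi => h i (Finset.mem_insert_of_mem hi))

omit [IsOrderedCancelAddMonoid Γ] in
theorem X (v : V) : IsLead l (Finsupp.single v 1) (MvPolynomial.X v : MvPolynomial V k) := by
  classical
  refine ⟨by simp, fun m hm => Or.inl ?_⟩
  by_contra h
  rw [mem_support_iff, coeff_X, if_neg (Ne.symm h)] at hm
  exact hm rfl

omit [IsOrderedCancelAddMonoid Γ] in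
/-- Adding terms of smaller weight does not change the leading monomial. -/
theorem add_of_lt (hP : IsLead l e P) (hQ : ∀ m ∈ Q.support, l m < l e) :
    IsLead l e (P + Q) := by
  classical
  have h0 : coeff e Q = 0 := by
    by_contra h
    exact lt_irrefl _ (hQ e (mem_support_iff.2 h))
  refine ⟨by rw [coeff_add, hP.1, h0, add_zero], fun m hm => ?_⟩
  rcases Finset.mem_union.1 (support_add hm) with h | h
  exacts [hP.2 m h, Or.inr (hQ m h)]

omit [IsOrderedCancelAddMonoid Γ] in
theorem sum_monomial {ι : Type*} [DecidableEq ι] {s : Finset ι} {m : ι → V →₀ ℕ} {c : ι → k}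
    {i : ι} (hi : i ∈ s) (hc : c i = 1) (h : ∀ j ∈ s, j ≠ i → l (m j) < l (m i)) :
    IsLead l (m i) (∑ j ∈ s, monomial (m j) (c j)) := by
  classical
  have h1 : ∀ n ∈ (∑ j ∈ s.erase i, monomial (m j) (c j)).support, l n < l (m i) := by
    intro n hn
    obtain ⟨j, hj, hn⟩ := Finset.mem_biUnion.1 (support_sum hn)
    rw [Finset.mem_erase] at hj
    rw [Finset.mem_singleton.1 (support_monomial_subset hn)]
    exact h j hj.2 hj.1
  rw [← Finset.add_sum_erase s _ hi]
  refine add_of_lt ⟨by simp [hc], fun n hn => Or.inl ?_⟩ h1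
  exact Finset.mem_singleton.1 (support_monomial_subset hn)

end IsLead

end Weights

/-! ### The dominance order on monomials -/

section Dominance

variable {p n : ℕ}

/-- Indices of the variables of the coordinate ring of pairs `(D, X)`, where `D` is a diagonal
`n × n` matrix, with entries in row `0`, and `X` is a `p × n` matrix, with entries in the rows
`1, …, p`. -/
abbrev DiagIdx (p n : ℕ) := Fin (p + 1) × Fin n

/-- The sums of the exponents of a monomial over the rectangles in the top left corner. -/
noncomputable def rectSums (p n : ℕ) :
    (DiagIdx p n →₀ ℕ) →+ (Fin n ×ₗ Fin (p + 1) → ℕ) :=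
  Finsupp.weight fun v j =>
    if v.1.val + (ofLex j).2.val ≤ p ∧ v.2 ≤ (ofLex j).1 then 1 else 0

theorem rectSums_apply (m : DiagIdx p n →₀ ℕ) (j : Fin n ×ₗ Fin (p + 1)) :
    rectSums p n m j =
      ∑ v with v.1.val + (ofLex j).2.val ≤ p ∧ v.2 ≤ (ofLex j).1, m v := by
  rw [rectSums, Finsupp.weight_eq_sum, Finset.sum_apply, Finset.sum_filter]
  refine Finset.sum_congr rfl fun v _ => ?_
  simp

theorem rectSums_single (v : DiagIdx p n) (j : Fin n ×ₗ Fin (p + 1)) :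
    rectSums p n (Finsupp.single v 1) j =
      if v.1.val + (ofLex j).2.val ≤ p ∧ v.2 ≤ (ofLex j).1 then 1 else 0 := by
  rw [rectSums, Finsupp.weight_single, one_smul]

theorem rectSums_injective : Function.Injective (rectSums p n) := by
  intro m m' h
  have key : ∀ v : Fin n ×ₗ Fin (p + 1),
      m ((ofLex v).2, (ofLex v).1) = m' ((ofLex v).2, (ofLex v).1) := by
    intro v
    induction v using WellFoundedLT.induction with
    | ind v ih =>
      have h1 := congrFun h (toLex ((ofLex v).1, (ofLex v).2.rev))
      rw [rectSums_apply, rectSums_apply] at h1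
      have hmem : ((ofLex v).2, (ofLex v).1) ∈ Finset.univ.filter (fun w : DiagIdx p n =>
          w.1.val + (ofLex (toLex ((ofLex v).1, (ofLex v).2.rev))).2.val ≤ p ∧
            w.2 ≤ (ofLex (toLex ((ofLex v).1, (ofLex v).2.rev))).1) := by
        refine Finset.mem_filter.2 ⟨Finset.mem_univ _, ?_, le_rfl⟩
        simp only [ofLex_toLex, Fin.val_rev]
        omega
      rw [← Finset.add_sum_erase _ _ hmem, ← Finset.add_sum_erase _ _ hmem] at h1
      refine Nat.add_right_cancel (h1.trans (congrArg _ (Finset.sum_congr rfl fun w hw => ?_)))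
      refine (ih (toLex (w.2, w.1)) ?_).symm
      rw [Prod.Lex.lt_iff]
      obtain ⟨hne, hw⟩ := Finset.mem_erase.1 hw
      obtain ⟨hw1, hw2⟩ := (Finset.mem_filter.1 hw).2
      simp only [ofLex_toLex, Fin.val_rev] at hw1 hw2
      rcases hw2.lt_or_eq with h2 | h2
      · exact Or.inl h2
      · refine Or.inr ⟨h2, ?_⟩
        have : w.1 ≤ (ofLex v).2 := by
          rw [Fin.le_def]
          have := (ofLex v).2.isLt
          omega
        exact this.lt_of_ne fun h3 => hne (Prod.ext h3 h2)
  ext v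
  exact key (toLex (v.2, v.1))

end Dominance

/-! ### The parametrisation of symmetric matrices -/

section Parametrisation

open MvPolynomial

/-- Indices of the entries of a symmetric matrix. -/
abbrev SymIdx (p : ℕ) := {ij : Fin p × Fin p // ij.1 ≤ ij.2}

variable (k : Type*) [Field k] (p n : ℕ)

/-- The entries of the generic symmetric matrix. -/
noncomputable def symVar {p : ℕ} (a b : Fin p) : MvPolynomial (SymIdx p) k :=
  X ⟨(min a b, max a b), min_le_max⟩

/-- The minors of the generic symmetric matrix. -/
noncomputable def symMinor {p s : ℕ} (a b : Fin s → Fin p) : MvPolynomial (SymIdx p) k :=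
  Matrix.det (Matrix.of fun i j => symVar k (a i) (b j))

/-- The homomorphism substituting `X D Xᵀ` into polynomials on symmetric matrices. -/
noncomputable def symParam :
    MvPolynomial (SymIdx p) k →ₐ[k] MvPolynomial (DiagIdx p n) k :=
  aeval fun ij => ∑ l, X (0, l) * X (ij.1.1.succ, l) * X (ij.1.2.succ, l)

variable {k p n}

theorem symParam_symVar (a b : Fin p) :
    symParam k p n (symVar k a b) = ∑ l, X (0, l) * X (a.succ, l) * X (b.succ, l) := by
  rw [symParam, symVar, aeval_X]
  rcases le_total a b with h | h
  · simp [h]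
  · simp [h, mul_right_comm]

theorem symVar_of_le (ij : SymIdx p) : symVar k ij.1.1 ij.1.2 = X ij := by
  rw [symVar]
  congr 1
  exact Subtype.ext (Prod.ext (min_eq_left ij.2) (max_eq_right ij.2))

theorem symVar_comm (a b : Fin p) : symVar k a b = symVar k b a := by
  simp only [symVar, min_comm a b, max_comm a b]

/-- A symmetric matrix is a combination of squares of linear forms, with coefficients that are
linear in the entries of the matrix. -/
theorem symParam_injective (hn : p * p ≤ n) : Function.Injective (symParam k p n) := by
  classical
  let e : Fin p × Fin p ↪ Fin n := finProdFinEquiv.toEmbedding.trans (Fin.castLEEmb hn)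
  let d : Fin p × Fin p → MvPolynomial (SymIdx p) k := fun q =>
    if q.1 < q.2 then symVar k q.1 q.2
    else if q.1 = q.2 then
      symVar k q.1 q.1 - ∑ c with c ≠ q.1, symVar k q.1 c
    else 0
  let g : DiagIdx p n → MvPolynomial (SymIdx p) k := fun v =>
    Fin.cases (∑ q with e q = v.2, d q)
      (fun a => if ∃ q, e q = v.2 ∧ (a = q.1 ∨ a = q.2) then 1 else 0) v.1
  have hg0 : ∀ q, g (0, e q) = d q := by
    intro q
    change ∑ q' with e q' = e q, d q' = d q
    rw [Finset.sum_eq_single q] <;> simp +contextual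
  have hg0' : ∀ l, (∀ q, e q ≠ l) → g (0, l) = 0 := by
    intro l hl
    change ∑ q' with e q' = l, d q' = 0
    exact Finset.sum_eq_zero fun q hq => absurd (Finset.mem_filter.1 hq).2 (hl q)
  have hg1 : ∀ (a : Fin p) q, g (a.succ, e q) = if a = q.1 ∨ a = q.2 then 1 else 0 := by
    intro a q
    change (if ∃ q', e q' = e q ∧ (a = q'.1 ∨ a = q'.2) then 1 else 0) = _
    simp
  have hcomp : (aeval g).comp (symParam k p n) = AlgHom.id k _ := by
    refine MvPolynomial.algHom_ext fun ij => ?_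
    rw [AlgHom.comp_apply, AlgHom.id_apply, ← symVar_of_le, symParam_symVar]
    obtain ⟨⟨a, b⟩, hab⟩ := ij
    simp only [map_sum, map_mul, aeval_X]
    have h1 : ∑ l, g (0, l) * g (a.succ, l) * g (b.succ, l) =
        ∑ q, g (0, e q) * g (a.succ, e q) * g (b.succ, e q) := by
      symm
      rw [← Finset.sum_map Finset.univ e (fun l => g (0, l) * g (a.succ, l) * g (b.succ, l))]
      refine Finset.sum_subset (Finset.subset_univ _) fun l _ hl => ?_
      rw [hg0' l, zero_mul, zero_mul]
      intro q hq
      exact hl (Finset.mem_map.2 ⟨q, Finset.mem_univ _, hq⟩)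
    rw [h1]
    simp only [hg0, hg1, mul_ite, mul_one, mul_zero]
    simp only at hab
    rcases hab.lt_or_eq with hlt | rfl
    · rw [Finset.sum_eq_single (a, b)]
      · simp [d, hlt]
      · rintro ⟨x, y⟩ - hne
        by_cases hb : b = x ∨ b = y
        · by_cases ha : a = x ∨ a = y
          · have hx : x = b ∧ y = a := by
              rcases ha with rfl | rfl <;> rcases hb with rfl | rfl <;> simp_all
            simp [d, hx.1, hx.2, hlt.not_gt, hlt.ne']
          · simp [ha]
        · simp [hb]
      · simp
    · have hF : ∀ x y : Fin p,
          (if a = x ∨ a = y then if a = x ∨ a = y then d (x, y) else 0 else 0) =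
            (if x = a then if y = a then
              symVar k a a - ∑ c with c ≠ a, symVar k a c else 0 else 0) +
            ((if x = a then if a < y then symVar k a y else 0 else 0) +
            (if y = a then if x < a then symVar k a x else 0 else 0)) := by
        intro x y
        by_cases hx : x = a
        · subst hx
          rcases lt_trichotomy x y with h | h | h
          · simp [d, h, h.ne']
          · simp [d, h]
          · simp [d, h.ne, h.ne', h.not_gt]
        · by_cases hy : y = a
          · subst hy
            simp [d, hx, Ne.symm hx, symVar_comm y x]
          · simp [hx, hy, Ne.symm hx, Ne.symm hy]
      have hS : ∑ c with c ≠ a, symVar k a c =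
          ∑ c, ((if a < c then symVar k a c else 0) + if c < a then symVar k a c else 0) := by
        rw [Finset.sum_filter]
        refine Finset.sum_congr rfl fun c _ => ?_
        rcases lt_trichotomy c a with h | h | h
        · simp [h, h.ne, h.not_gt]
        · simp [h]
        · simp [h, h.ne', h.not_gt]
      rw [Fintype.sum_prod_type]
      simp only [hF, Finset.sum_add_distrib, hS]
      rw [Finset.sum_comm (f := fun x y : Fin p =>
        if y = a then if x < a then symVar k a x else 0 else 0)]
      simp
  exact Function.LeftInverse.injective (g := aeval g) fun f => DFunLike.congr_fun hcomp f

end Parametrisation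

/-! ### Lexicographic comparison of monomials that differ in two columns -/

section TwoColumns

variable {p n : ℕ}

/-- In each column, the exponents in the rows `1, …, p` add up to twice the exponent in
row `0`. -/
def IsBalanced (m : DiagIdx p n →₀ ℕ) : Prop :=
  ∀ l, ∑ a : Fin p, m (a.succ, l) = 2 * m (0, l)

theorem rectSums_sub {M M' : DiagIdx p n →₀ ℕ} {i : Fin n}
    (h : ∀ c, ∀ l < i, M' (c, l) = M (c, l)) (b : Fin (p + 1)) :
    (rectSums p n M' (toLex (i, b)) : ℤ) - rectSums p n M (toLex (i, b)) =
      ∑ c : Fin (p + 1), if c.val + b.val ≤ p then (M' (c, i) : ℤ) - M (c, i) else 0 := by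
  classical
  rw [rectSums_apply, rectSums_apply]
  push_cast
  rw [← Finset.sum_sub_distrib, Finset.sum_filter, Fintype.sum_prod_type]
  refine Finset.sum_congr rfl fun c _ => ?_
  rw [Finset.sum_eq_single i]
  · simp
  · intro l _ hl
    split_ifs with hc
    · rw [h c l (lt_of_le_of_ne hc.2 hl), sub_self]
    · rfl
  · simp

variable {M M' : DiagIdx p n →₀ ℕ} {i j : Fin n}

theorem rectSums_eq_of_lt (hij : i < j)
    (hother : ∀ c l, l ≠ i → l ≠ j → M' (c, l) = M (c, l)) {l : Fin n} (hl : l < i)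
    (b : Fin (p + 1)) : rectSums p n M' (toLex (l, b)) = rectSums p n M (toLex (l, b)) := by
  have h1 : ∀ c, ∀ l' ≤ l, M' (c, l') = M (c, l') := fun c l' hl' =>
    hother c l' (hl'.trans_lt hl).ne ((hl'.trans_lt hl).trans hij).ne
  have h2 := rectSums_sub (fun c l' hl' => h1 c l' hl'.le) b (i := l)
  rw [Finset.sum_eq_zero] at h2
  · omega
  · intro c _
    rw [h1 c l le_rfl, sub_self, ite_self]

theorem eq_row_zero_of_lex_le (hij : i < j)
    (hother : ∀ c l, l ≠ i → l ≠ j → M' (c, l) = M (c, l))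
    (hsum : ∀ a : Fin p, M' (a.succ, i) + M' (a.succ, j) = M (a.succ, i) + M (a.succ, j))
    (hb : IsBalanced M) (hb' : IsBalanced M') (h0 : M' (0, j) ≤ M (0, j))
    (hkey : toLex (rectSums p n M') ≤ toLex (rectSums p n M)) :
    M' (0, i) = M (0, i) ∧ M' (0, j) = M (0, j) := by
  have h1 : rectSums p n M' (toLex (i, 0)) ≤ rectSums p n M (toLex (i, 0)) := by
    refine Pi.apply_le_of_toLex hkey fun J hJ => ?_
    rcases Prod.Lex.lt_iff.1 hJ with h | ⟨-, h⟩
    · exact rectSums_eq_of_lt hij hother h _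
    · exact absurd h (Fin.not_lt_zero _)
  have h2 := rectSums_sub (fun c l hl => hother c l hl.ne (hl.trans hij).ne) 0 (i := i)
  have h3 : (∑ a : Fin p, M' (a.succ, i)) + ∑ a : Fin p, M' (a.succ, j) =
      (∑ a : Fin p, M (a.succ, i)) + ∑ a : Fin p, M (a.succ, j) := by
    rw [← Finset.sum_add_distrib, ← Finset.sum_add_distrib]
    exact Finset.sum_congr rfl fun a _ => hsum a
  have h4 : (∑ c : Fin (p + 1), if c.val + (0 : Fin (p + 1)).val ≤ p then
      (M' (c, i) : ℤ) - M (c, i) else 0) = 3 * ((M' (0, i) : ℤ) - M (0, i)) := by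
    have h5 : ∀ c : Fin (p + 1), c.val + (0 : Fin (p + 1)).val ≤ p := fun c => by
      have := c.isLt
      simp only [Fin.val_zero]
      omega
    simp only [h5, if_true]
    rw [Fin.sum_univ_succ, Finset.sum_sub_distrib]
    have h6 := hb i
    have h7 := hb' i
    zify at h6 h7
    rw [h6, h7]
    ring
  rw [hb' i, hb' j, hb i, hb j] at h3
  omega

theorem eq_rows_of_lex_le (hij : i < j)
    (hother : ∀ c l, l ≠ i → l ≠ j → M' (c, l) = M (c, l))
    (hb : IsBalanced M) (hb' : IsBalanced M') (h0 : M' (0, i) = M (0, i))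
    (hkey : toLex (rectSums p n M') ≤ toLex (rectSums p n M)) {k : ℕ}
    (hk : ∀ a : Fin p, k ≤ a → M' (a.succ, i) ≤ M (a.succ, i)) :
    ∀ a : Fin p, k ≤ a → M' (a.succ, i) = M (a.succ, i) := by
  have htot : ∑ c : Fin (p + 1), ((M' (c, i) : ℤ) - M (c, i)) = 0 := by
    rw [Fin.sum_univ_succ, Finset.sum_sub_distrib]
    have h6 := hb i
    have h7 := hb' i
    zify at h6 h7
    rw [h6, h7, h0]
    ring
  have hsub : ∀ b : Fin (p + 1),
      (rectSums p n M' (toLex (i, b)) : ℤ) - rectSums p n M (toLex (i, b)) =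
        - ∑ c : Fin (p + 1), if p < c.val + b.val then (M' (c, i) : ℤ) - M (c, i) else 0 := by
    intro b
    rw [rectSums_sub (fun c l hl => hother c l hl.ne (hl.trans hij).ne) b, eq_neg_iff_add_eq_zero,
      ← Finset.sum_add_distrib, ← htot]
    refine Finset.sum_congr rfl fun c _ => ?_
    split_ifs <;> omega
  intro a
  induction a using WellFoundedGT.induction with
  | ind a ih =>
    intro ha
    refine (hk a ha).antisymm ?_
    have hzero : ∀ c : Fin (p + 1), a.val + 1 < c.val → (M' (c, i) : ℤ) - M (c, i) = 0 := by
      intro c hc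
      obtain ⟨a', rfl⟩ := Fin.exists_succ_eq.2 (show c ≠ 0 by rintro rfl; simp at hc)
      have hlt : a < a' := by
        rw [Fin.lt_def]
        rw [Fin.val_succ] at hc
        omega
      rw [ih a' hlt (ha.trans (Fin.lt_def.1 hlt).le), sub_self]
    let b : Fin (p + 1) := ⟨p - a.val, by omega⟩
    have hle : rectSums p n M' (toLex (i, b)) ≤ rectSums p n M (toLex (i, b)) := by
      refine Pi.apply_le_of_toLex hkey fun J hJ => ?_
      rcases Prod.Lex.lt_iff.1 hJ with h | ⟨h1, h2⟩
      · exact rectSums_eq_of_lt hij hother h _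
      · obtain ⟨l, b'⟩ := J
        change l = i at h1
        change b' < b at h2
        subst h1
        have h3 := hsub b'
        rw [Finset.sum_eq_zero] at h3
        · change rectSums p n M' (toLex (l, b')) = rectSums p n M (toLex (l, b'))
          omega
        · intro c _
          rw [Fin.lt_def] at h2
          simp only [b] at h2
          split_ifs
          · exact hzero c (by omega)
          · rfl
    have h3 := hsub b
    rw [Finset.sum_eq_single a.succ] at h3
    · rw [if_pos (by simp only [b, Fin.val_succ]; omega)] at h3
      omega
    · intro c _ hc
      rw [Ne, Fin.ext_iff, Fin.val_succ] at hc
      simp only [b]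
      split_ifs
      · exact hzero c (by omega)
      · rfl
    · simp

end TwoColumns

/-! ### The ballot condition for extremal monomials -/

section Ballot

open MvPolynomial

variable {p n : ℕ}

/-- The function on the variables given by `A` on the column `i`, by `B` on the column `j`, and by
`G` elsewhere. -/
def replaceColumns {T : Type*} (i j : Fin n) (A B : Fin (p + 1) → T) (G : DiagIdx p n → T)
    (v : DiagIdx p n) : T :=
  if v.2 = i then A v.1 else if v.2 = j then B v.1 else G v

section

variable {T : Type*} {i j l : Fin n} {A B : Fin (p + 1) → T} {G : DiagIdx p n → T}

theorem replaceColumns_left (c : Fin (p + 1)) : replaceColumns i j A B G (c, i) = A c := by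
  simp [replaceColumns]

theorem replaceColumns_right (hij : i < j) (c : Fin (p + 1)) :
    replaceColumns i j A B G (c, j) = B c := by
  simp [replaceColumns, hij.ne']

theorem replaceColumns_of_ne (hi : l ≠ i) (hj : l ≠ j) (c : Fin (p + 1)) :
    replaceColumns i j A B G (c, l) = G (c, l) := by
  simp [replaceColumns, hi, hj]

theorem forall_diagIdx (i j : Fin n) {P : DiagIdx p n → Prop}
    (h1 : ∀ c l, l ≠ i → l ≠ j → P (c, l)) (h2 : P (0, i)) (h3 : P (0, j))
    (h4 : ∀ a : Fin p, P (a.succ, i)) (h5 : ∀ a : Fin p, P (a.succ, j)) (v : DiagIdx p n) :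
    P v := by
  obtain ⟨c, l⟩ := v
  by_cases hi : l = i
  · subst hi
    exact Fin.cases h2 h4 c
  · by_cases hj : l = j
    · subst hj
      exact Fin.cases h3 h5 c
    · exact h1 c l hi hj

end

variable (k : Type*) [Field k] (i j : Fin n) (a₀ : Fin p)

/-- The scaling factors of the column `i`. -/
noncomputable def scaleLeft (a : Fin p) : MvPolynomial (DiagIdx p n) k :=
  if a < a₀ then 1 + X (a.succ, i) else 1

/-- The scaling factors of the column `j`. -/
noncomputable def scaleRight (a : Fin p) : MvPolynomial (DiagIdx p n) k :=
  if a₀ < a then X (a.succ, i) else 1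

/-- A substitution for the columns `i` and `j`. -/
noncomputable def substOne : DiagIdx p n → MvPolynomial (DiagIdx p n) k :=
  replaceColumns i j
    (Fin.cases (1 + X (0, j)) fun a => X (a.succ, j) * scaleLeft k i a₀ a)
    (Fin.cases (X (0, j) * (1 + X (0, j))) fun a => X (a.succ, j) * scaleRight k i a₀ a) X

/-- A substitution for the columns `i` and `j` that has the same effect on symmetric matrices as
`substOne`. -/
noncomputable def substTwo : DiagIdx p n → MvPolynomial (DiagIdx p n) k :=
  replaceColumns i j
    (Fin.cases 1 fun a =>
      X (a.succ, j) * (scaleLeft k i a₀ a + X (0, j) * scaleRight k i a₀ a))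
    (Fin.cases (X (0, j)) fun a =>
      X (a.succ, j) * (scaleRight k i a₀ a - scaleLeft k i a₀ a)) X

/-- The leading exponents of `substOne`. -/
noncomputable def substExp : DiagIdx p n → DiagIdx p n →₀ ℕ :=
  replaceColumns i j
    (Fin.cases 0 fun a =>
      Finsupp.single (a.succ, j) 1 + if a < a₀ then Finsupp.single (a.succ, i) 1 else 0)
    (Fin.cases (Finsupp.single (0, j) 1) fun a =>
      Finsupp.single (a.succ, j) 1 + if a₀ < a then Finsupp.single (a.succ, i) 1 else 0)
    fun v => Finsupp.single v 1

variable {k i j a₀}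

theorem sum_eq_sum_of_two {T : Type*} [AddCommMonoid T] {F G : Fin n → T} (hij : i < j)
    (h : F i + F j = G i + G j) (h' : ∀ l, l ≠ i → l ≠ j → F l = G l) :
    ∑ l, F l = ∑ l, G l := by
  classical
  have hj : j ∈ Finset.univ.erase i := by simp [hij.ne']
  rw [← Finset.add_sum_erase _ F (Finset.mem_univ i), ← Finset.add_sum_erase _ F hj,
    ← Finset.add_sum_erase _ G (Finset.mem_univ i), ← Finset.add_sum_erase _ G hj,
    ← add_assoc, ← add_assoc, h]
  refine congrArg _ (Finset.sum_congr rfl fun l hl => ?_)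
  simp only [Finset.mem_erase, Finset.mem_univ, and_true] at hl
  exact h' l hl.2 hl.1

theorem two_squares_identity {T : Type*} [CommRing T] (e r r' x x' y y' : T) :
    (1 + e) * (r * x) * (r' * x') + e * (1 + e) * (r * y) * (r' * y') =
      1 * (r * (x + e * y)) * (r' * (x' + e * y')) +
        e * (r * (y - x)) * (r' * (y' - x')) := by
  ring

theorem aeval_substOne_symParam (hij : i < j) (f : MvPolynomial (SymIdx p) k) :
    aeval (substOne k i j a₀) (symParam k p n f) =
      aeval (substTwo k i j a₀) (symParam k p n f) := by
  suffices (aeval (substOne k i j a₀)).comp (symParam k p n) =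
      (aeval (substTwo k i j a₀)).comp (symParam k p n) from DFunLike.congr_fun this f
  refine MvPolynomial.algHom_ext fun ab => ?_
  rw [AlgHom.comp_apply, AlgHom.comp_apply, ← symVar_of_le, symParam_symVar]
  simp only [map_sum, map_mul, aeval_X]
  refine sum_eq_sum_of_two hij ?_ fun l hi hj => ?_
  · simp only [substOne, substTwo, replaceColumns_left, replaceColumns_right hij, Fin.cases_zero,
      Fin.cases_succ]
    exact two_squares_identity _ _ _ _ _ _ _
  · simp only [substOne, substTwo, replaceColumns_of_ne hi hj]

theorem isLead_one_add_X {V : Type*} {l : (V →₀ ℕ) →+ ℤ} {v : V}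
    (hl : l (Finsupp.single v 1) < 0) : IsLead l 0 (1 + X v : MvPolynomial V k) := by
  refine IsLead.one.add_of_lt fun m hm => ?_
  rw [support_X, Finset.mem_singleton] at hm
  rwa [hm, map_zero]

theorem isLead_one_add_X_of_pos {V : Type*} {l : (V →₀ ℕ) →+ ℤ} {v : V}
    (hl : 0 < l (Finsupp.single v 1)) :
    IsLead l (Finsupp.single v 1) (1 + X v : MvPolynomial V k) := by
  rw [add_comm]
  refine (IsLead.X v).add_of_lt fun m hm => ?_
  rw [support_one, Finset.mem_singleton] at hm
  rwa [hm, map_zero]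

theorem isLead_substOne (hij : i < j) (v : DiagIdx p n) :
    IsLead (Finsupp.weight (replaceColumns i j (fun _ => 1) (fun _ => -1) 0 : DiagIdx p n → ℤ))
      (substExp i j a₀ v) (substOne k i j a₀ v) := by
  have hi : ∀ c : Fin (p + 1), 0 < Finsupp.weight (replaceColumns i j (fun _ => 1) (fun _ => -1) 0 :
      DiagIdx p n → ℤ) (Finsupp.single (c, i) 1) := fun c => by
    simp [Finsupp.weight_single, replaceColumns_left]
  have hj : ∀ c : Fin (p + 1), Finsupp.weight (replaceColumns i j (fun _ => 1) (fun _ => -1) 0 :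
      DiagIdx p n → ℤ) (Finsupp.single (c, j) 1) < 0 := fun c => by
    simp [Finsupp.weight_single, replaceColumns_right hij]
  induction v using forall_diagIdx i j with
  | h1 c l hi hj =>
    simp only [substOne, substExp, replaceColumns_of_ne hi hj]
    exact IsLead.X _
  | h2 =>
    simp only [substOne, substExp, replaceColumns_left, Fin.cases_zero]
    exact isLead_one_add_X (hj 0)
  | h3 =>
    simp only [substOne, substExp, replaceColumns_right hij, Fin.cases_zero]
    simpa using (IsLead.X _).mul (isLead_one_add_X (hj 0))
  | h4 a =>
    simp only [substOne, substExp, replaceColumns_left, Fin.cases_succ, scaleLeft]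
    split_ifs with h
    · exact (IsLead.X _).mul (isLead_one_add_X_of_pos (hi _))
    · exact (IsLead.X _).mul IsLead.one
  | h5 a =>
    simp only [substOne, substExp, replaceColumns_right hij, Fin.cases_succ, scaleRight]
    split_ifs with h
    · exact (IsLead.X _).mul (IsLead.X _)
    · exact (IsLead.X _).mul IsLead.one

end Ballot

section Ballot

open MvPolynomial

variable {p n : ℕ} {k : Type*} [Field k] {i j : Fin n} {a₀ : Fin p}

theorem weightGE_substOne (hij : i < j) {w : DiagIdx p n → ℤ} (h0 : 0 ≤ w (0, j))
    (h1 : ∀ a < a₀, w (a.succ, i) ≤ 0) (v : DiagIdx p n) :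
    WeightGE (Finsupp.weight w) (Finsupp.weight w (substExp i j a₀ v))
      (substOne k i j a₀ v) := by
  induction v using forall_diagIdx i j with
  | h1 c l hi hj =>
    simp only [substOne, substExp, replaceColumns_of_ne hi hj]
    exact WeightGE.X le_rfl
  | h2 =>
    simp only [substOne, substExp, replaceColumns_left, Fin.cases_zero, map_zero]
    exact WeightGE.one.add (WeightGE.X (by simpa [Finsupp.weight_single] using h0))
  | h3 =>
    simp only [substOne, substExp, replaceColumns_right hij, Fin.cases_zero]
    rw [← add_zero (Finsupp.weight w _)]
    exact (WeightGE.X le_rfl).mul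
      (WeightGE.one.add (WeightGE.X (by simpa [Finsupp.weight_single] using h0)))
  | h4 a =>
    simp only [substOne, substExp, replaceColumns_left, Fin.cases_succ, scaleLeft, map_add]
    refine (WeightGE.X le_rfl).mul ?_
    split_ifs with h
    · have := h1 a h
      exact (WeightGE.one.mono (by simpa [Finsupp.weight_single])).add (WeightGE.X le_rfl)
    · simpa using WeightGE.one
  | h5 a =>
    simp only [substOne, substExp, replaceColumns_right hij, Fin.cases_succ, scaleRight, map_add]
    refine (WeightGE.X le_rfl).mul ?_
    split_ifs with h
    · exact WeightGE.X le_rfl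
    · simpa using WeightGE.one

theorem weightGE_substTwo (hij : i < j) {w : DiagIdx p n → ℤ} (h0 : 0 ≤ w (0, j))
    (h1 : ∀ a < a₀, w (a.succ, i) = 0)
    (h2 : ∀ a, a₀ < a → w (a.succ, i) ≤ 0 ∧ 0 ≤ w (0, j) + w (a.succ, i)) (v : DiagIdx p n) :
    WeightGE (Finsupp.weight w) (Finsupp.weight w (substExp i j a₀ v))
      (substTwo k i j a₀ v) := by
  have he : Finsupp.weight w (Finsupp.single (0, j) 1) = w (0, j) := by
    simp [Finsupp.weight_single]
  have hv : ∀ a : Fin p, Finsupp.weight w (Finsupp.single (a.succ, i) 1) = w (a.succ, i) :=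
    fun a => by simp [Finsupp.weight_single]
  have hX : ∀ v, WeightGE (Finsupp.weight w) (w v) (X v : MvPolynomial (DiagIdx p n) k) :=
    fun v => WeightGE.X (by simp [Finsupp.weight_single])
  induction v using forall_diagIdx i j with
  | h1 c l hi hj =>
    simp only [substTwo, substExp, replaceColumns_of_ne hi hj]
    exact WeightGE.X le_rfl
  | h2 =>
    simp only [substTwo, substExp, replaceColumns_left, Fin.cases_zero, map_zero]
    exact WeightGE.one
  | h3 =>
    simp only [substTwo, substExp, replaceColumns_right hij, Fin.cases_zero]
    exact WeightGE.X le_rfl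
  | h4 a =>
    simp only [substTwo, substExp, replaceColumns_left, Fin.cases_succ, scaleLeft, scaleRight,
      map_add]
    refine (WeightGE.X le_rfl).mul ?_
    rcases lt_trichotomy a a₀ with h | rfl | h
    · simp only [h, h.not_gt, if_true, if_false, hv, h1 a h, mul_one]
      exact (WeightGE.one.add ((hX _).mono (h1 a h).ge)).add ((hX _).mono h0)
    · simp only [lt_irrefl, if_false, map_zero, mul_one]
      exact WeightGE.one.add ((hX _).mono h0)
    · simp only [h, h.not_gt, if_true, if_false, map_zero]
      exact WeightGE.one.add (((hX _).mul (hX _)).mono (h2 a h).2)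
  | h5 a =>
    simp only [substTwo, substExp, replaceColumns_right hij, Fin.cases_succ, scaleLeft, scaleRight,
      map_add]
    refine (WeightGE.X le_rfl).mul ?_
    rcases lt_trichotomy a a₀ with h | rfl | h
    · simp only [h, h.not_gt, if_true, if_false, map_zero]
      exact WeightGE.one.sub (WeightGE.one.add ((hX _).mono (h1 a h).ge))
    · simp only [lt_irrefl, if_false, map_zero, sub_self]
      exact WeightGE.zero
    · simp only [h, h.not_gt, if_true, if_false, hv]
      exact (hX _).sub (WeightGE.one.mono (h2 a h).1)

variable (i j a₀) in
/-- The monomial obtained from `M` by replacing each variable by its leading exponent under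
`substOne`. -/
noncomputable def substMono (M : DiagIdx p n →₀ ℕ) : DiagIdx p n →₀ ℕ :=
  ∑ v, M v • substExp i j a₀ v

variable {M : DiagIdx p n →₀ ℕ}

theorem substMono_apply (u : DiagIdx p n) :
    substMono i j a₀ M u = ∑ v, M v * substExp i j a₀ v u := by
  simp [substMono, Finsupp.finsetSum_apply]

theorem substMono_of_ne (hij : i < j) {l : Fin n} (hi : l ≠ i) (hj : l ≠ j) (c : Fin (p + 1)) :
    substMono i j a₀ M (c, l) = M (c, l) := by
  classical
  rw [substMono_apply, Finset.sum_eq_single (c, l)]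
  · simp [substExp, replaceColumns_of_ne hi hj]
  · intro v _
    induction v using forall_diagIdx i j with
    | h1 c' l' hi' hj' => intro h; simp [substExp, replaceColumns_of_ne hi' hj', h]
    | h2 => simp [substExp, replaceColumns_left]
    | h3 => simp [substExp, replaceColumns_right hij, hj.symm]
    | h4 a =>
      intro _
      simp only [substExp, replaceColumns_left, Fin.cases_succ]
      split_ifs <;> simp [hi.symm, hj.symm]
    | h5 a =>
      intro _
      simp only [substExp, replaceColumns_right hij, Fin.cases_succ]
      split_ifs <;> simp [hi.symm, hj.symm]
  · simp

theorem substMono_zero_right (hij : i < j) : substMono i j a₀ M (0, j) = M (0, j) := by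
  classical
  rw [substMono_apply, Finset.sum_eq_single (0, j)]
  · simp [substExp, replaceColumns_right hij]
  · intro v _
    induction v using forall_diagIdx i j with
    | h1 c' l' hi' hj' => intro h; simp [substExp, replaceColumns_of_ne hi' hj', hj']
    | h2 => simp [substExp, replaceColumns_left]
    | h3 => simp
    | h4 a =>
      intro _
      simp only [substExp, replaceColumns_left, Fin.cases_succ]
      split_ifs <;> simp [Fin.succ_ne_zero]
    | h5 a =>
      intro _
      simp only [substExp, replaceColumns_right hij, Fin.cases_succ]
      split_ifs <;> simp [Fin.succ_ne_zero]
  · simp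

theorem substMono_succ_right (hij : i < j) (a : Fin p) :
    substMono i j a₀ M (a.succ, j) = M (a.succ, i) + M (a.succ, j) := by
  classical
  rw [substMono_apply, Finset.sum_eq_add (a.succ, i) (a.succ, j) (by simp [hij.ne])]
  · simp only [substExp, replaceColumns_left, replaceColumns_right hij, Fin.cases_succ]
    split_ifs <;> simp [hij.ne]
  · rintro v - ⟨h1, h2⟩
    induction v using forall_diagIdx i j with
    | h1 c' l' hi' hj' => simp [substExp, replaceColumns_of_ne hi' hj', hj']
    | h2 => simp [substExp, replaceColumns_left]
    | h3 => simp [substExp, replaceColumns_right hij]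
    | h4 a' =>
      have : a' ≠ a := by rintro rfl; exact h1 rfl
      simp only [substExp, replaceColumns_left, Fin.cases_succ]
      split_ifs <;> simp [this, hij.ne]
    | h5 a' =>
      have : a' ≠ a := by rintro rfl; exact h2 rfl
      simp only [substExp, replaceColumns_right hij, Fin.cases_succ]
      split_ifs <;> simp [this, hij.ne]
  · simp
  · simp

theorem substMono_succ_left (hij : i < j) (a : Fin p) :
    substMono i j a₀ M (a.succ, i) =
      if a < a₀ then M (a.succ, i) else if a₀ < a then M (a.succ, j) else 0 := by
  classical
  have key : ∀ v, substExp i j a₀ v (a.succ, i) =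
      if a < a₀ then (if v = (a.succ, i) then 1 else 0)
      else if a₀ < a then (if v = (a.succ, j) then 1 else 0) else 0 := by
    intro v
    induction v using forall_diagIdx i j with
    | h1 c' l' hi' hj' => simp [substExp, replaceColumns_of_ne hi' hj', hi', hj']
    | h2 => simp [substExp, replaceColumns_left, hij.ne, (Fin.succ_ne_zero _).symm]
    | h3 => simp [substExp, replaceColumns_right hij, hij.ne', (Fin.succ_ne_zero _).symm]
    | h4 a' =>
      simp only [substExp, replaceColumns_left, Fin.cases_succ]
      by_cases ha : a' = a
      · subst ha
        split_ifs <;> simp_all [hij.ne]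
      · split_ifs <;> simp_all [hij.ne]
    | h5 a' =>
      simp only [substExp, replaceColumns_right hij, Fin.cases_succ]
      by_cases ha : a' = a
      · subst ha
        split_ifs <;> simp_all [hij.ne, hij.ne', lt_asymm]
      · split_ifs <;> simp_all [hij.ne, hij.ne']
  simp only [substMono_apply, key]
  split_ifs <;> simp

end Ballot

section Ballot

open MvPolynomial

variable {p n : ℕ} {k : Type*} [Field k] {i j : Fin n} {a₀ : Fin p}

theorem weight_single_apply {V : Type*} [Fintype V] [DecidableEq V] (u : V) (c : ℤ) (m : V →₀ ℕ) :
    Finsupp.weight (Pi.single u c : V → ℤ) m = m u * c := by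
  rw [Finsupp.weight_eq_sum, Finset.sum_eq_single u]
  · simp
  · intro v _ hv
    simp [hv]
  · simp

theorem weight_le_of_mem_support_symParam {w : DiagIdx p n → ℤ}
    (hw : ∀ a b l, 0 ≤ w (0, l) + w (Fin.succ a, l) + w (Fin.succ b, l))
    {f : MvPolynomial (SymIdx p) k} {M : DiagIdx p n →₀ ℕ}
    (hM : M ∈ (symParam k p n f).support) : 0 ≤ Finsupp.weight w M := by
  refine WeightGE.aeval (fun ab => WeightGE.sum fun l _ => ?_) f M hM
  have hX : ∀ v, WeightGE (Finsupp.weight w) (w v) (X v : MvPolynomial (DiagIdx p n) k) :=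
    fun v => WeightGE.X (by simp [Finsupp.weight_single])
  exact (((hX _).mul (hX _)).mul (hX _)).mono (hw _ _ l)

theorem isBalanced_of_mem_support {f : MvPolynomial (SymIdx p) k} {M : DiagIdx p n →₀ ℕ}
    (hM : M ∈ (symParam k p n f).support) : IsBalanced M := by
  classical
  intro l
  let w : ℤ → DiagIdx p n → ℤ := fun s v => if v.2 = l then Fin.cases (-2 * s) (fun _ => s) v.1 else 0
  have h : ∀ s, 0 ≤ Finsupp.weight (w s) M := fun s => by
    refine weight_le_of_mem_support_symParam (fun a b l' => ?_) hM
    simp only [w, Fin.cases_zero, Fin.cases_succ]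
    split_ifs <;> omega
  have hval : ∀ s, Finsupp.weight (w s) M = (∑ a : Fin p, (M (a.succ, l) : ℤ) - 2 * M (0, l)) * s := by
    intro s
    rw [Finsupp.weight_eq_sum, Fintype.sum_prod_type, Fin.sum_univ_succ]
    simp only [w, smul_ite, smul_zero, Finset.sum_ite_eq', Finset.mem_univ, if_true, Fin.cases_zero,
      Fin.cases_succ, nsmul_eq_mul]
    rw [← Finset.sum_mul]
    ring
  have h1 := h 1
  have h2 := h (-1)
  rw [hval] at h1 h2
  zify
  linarith

theorem weight_substMono_le {w : DiagIdx p n → ℤ} {g : DiagIdx p n → MvPolynomial (DiagIdx p n) k}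
    (hg : ∀ v, WeightGE (Finsupp.weight w) (Finsupp.weight w (substExp i j a₀ v)) (g v))
    {M m : DiagIdx p n →₀ ℕ} (hm : coeff m (∏ v, g v ^ M v) ≠ 0) :
    Finsupp.weight w (substMono i j a₀ M) ≤ Finsupp.weight w m := by
  have h := WeightGE.prod (s := Finset.univ) (fun v _ => (hg v).pow (M v)) m (mem_support_iff.2 hm)
  simpa [substMono] using h

variable {M M' : DiagIdx p n →₀ ℕ}

/-- Consequences of comparing exponents that hold for both substitutions. -/
theorem compare_of_weights (hij : i < j) (hM : IsBalanced M) (hM' : IsBalanced M')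
    (hle : toLex (rectSums p n M') ≤ toLex (rectSums p n M))
    (h : ∀ u s, (∀ a, u ≠ (Fin.succ a, i)) → (u ≠ (0, j) ∨ 0 ≤ s) →
      (substMono i j a₀ M' u : ℤ) * s ≤ substMono i j a₀ M u * s) :
    (∀ c l, l ≠ i → l ≠ j → M' (c, l) = M (c, l)) ∧
      (∀ a : Fin p, M' (a.succ, i) + M' (a.succ, j) = M (a.succ, i) + M (a.succ, j)) ∧
      M' (0, i) = M (0, i) ∧ M' (0, j) = M (0, j) := by
  have hother : ∀ c l, l ≠ i → l ≠ j → M' (c, l) = M (c, l) := by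
    intro c l hi hj
    have h1 := h (c, l) 1 (by simp [hi]) (by simp [hj])
    have h2 := h (c, l) (-1) (by simp [hi]) (by simp [hj])
    rw [substMono_of_ne hij hi hj, substMono_of_ne hij hi hj] at h1 h2
    omega
  have hsum : ∀ a : Fin p, M' (a.succ, i) + M' (a.succ, j) = M (a.succ, i) + M (a.succ, j) := by
    intro a
    have h1 := h (a.succ, j) 1 (by simp [hij.ne']) (by simp)
    have h2 := h (a.succ, j) (-1) (by simp [hij.ne']) (by simp [Fin.succ_ne_zero])
    rw [substMono_succ_right hij, substMono_succ_right hij] at h1 h2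
    omega
  have h0 := h (0, j) 1 (by simp [hij.ne']) (by simp)
  rw [substMono_zero_right hij, substMono_zero_right hij] at h0
  exact ⟨hother, hsum, eq_row_zero_of_lex_le hij hother hsum hM hM' (by omega) hle⟩

theorem eq_of_coeff_substOne_ne_zero (hij : i < j) (hM : IsBalanced M) (hM' : IsBalanced M')
    (hle : toLex (rectSums p n M') ≤ toLex (rectSums p n M))
    (hne : coeff (substMono i j a₀ M) (∏ v, substOne k i j a₀ v ^ M' v) ≠ 0) : M' = M := by
  classical
  have h : ∀ u s, (u ≠ (0, j) ∨ 0 ≤ s) → (∀ a < a₀, u = (Fin.succ a, i) → s ≤ 0) →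
      (substMono i j a₀ M' u : ℤ) * s ≤ substMono i j a₀ M u * s := by
    intro u s h1 h2
    rw [← weight_single_apply, ← weight_single_apply]
    refine weight_substMono_le (weightGE_substOne hij ?_ fun a ha => ?_) hne
    · by_cases hu : (0, j) = u
      · subst hu
        simpa using h1
      · rw [Pi.single_eq_of_ne hu]
    · by_cases hu : (a.succ, i) = u
      · subst hu
        simpa using h2 a ha rfl
      · rw [Pi.single_eq_of_ne hu]
  obtain ⟨hother, hsum, h0i, h0j⟩ := compare_of_weights hij hM hM' hle (a₀ := a₀)
    fun u s h1 h2 => h u s h2 fun a _ ha => absurd ha (h1 a)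
  have hlow : ∀ a < a₀, M (a.succ, i) ≤ M' (a.succ, i) := by
    intro a ha
    have h1 := h (a.succ, i) (-1) (by simp [Fin.succ_ne_zero]) (by simp)
    rw [substMono_succ_left hij, substMono_succ_left hij, if_pos ha, if_pos ha] at h1
    omega
  have hhigh : ∀ a, a₀ < a → M' (a.succ, i) ≤ M (a.succ, i) := by
    intro a ha
    have h1 := h (a.succ, i) (-1) (by simp [Fin.succ_ne_zero]) (by simp)
    rw [substMono_succ_left hij, substMono_succ_left hij, if_neg ha.not_gt, if_neg ha.not_gt,
      if_pos ha, if_pos ha] at h1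
    have := hsum a
    omega
  have heq := eq_rows_of_lex_le hij hother hM hM' h0i hle (k := a₀ + 1) fun a ha => hhigh a ha
  have hge : ∀ a : Fin p, a ≠ a₀ → M (a.succ, i) ≤ M' (a.succ, i) := fun a ha =>
    ha.lt_or_gt.elim (hlow a) fun h => (heq a h).ge
  have htot : ∑ a : Fin p, M (a.succ, i) = ∑ a : Fin p, M' (a.succ, i) := by
    rw [hM i, hM' i, h0i]
  have h₀ : M' (a₀.succ, i) ≤ M (a₀.succ, i) := by
    rw [← Finset.add_sum_erase _ _ (Finset.mem_univ a₀),
      ← Finset.add_sum_erase _ (fun a : Fin p => M' (a.succ, i)) (Finset.mem_univ a₀)] at htot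
    have := Finset.sum_le_sum fun a (ha : a ∈ Finset.univ.erase a₀) =>
      hge a (Finset.ne_of_mem_erase ha)
    omega
  have heq' := eq_rows_of_lex_le hij hother hM hM' h0i hle (k := a₀) fun a ha =>
    (Fin.le_def.2 ha).eq_or_lt.elim (fun h => h ▸ h₀) (hhigh a)
  have hall : ∀ a : Fin p, M' (a.succ, i) = M (a.succ, i) := by
    intro a
    refine (((Finset.sum_eq_sum_iff_of_le fun a _ => ?_).1 htot) a (Finset.mem_univ a)).symm
    by_cases ha : a = a₀
    · subst ha
      exact (heq' a le_rfl).ge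
    · exact hge a ha
  ext v
  induction v using forall_diagIdx i j with
  | h1 c l hi hj => exact hother c l hi hj
  | h2 => exact h0i
  | h3 => exact h0j
  | h4 a => exact hall a
  | h5 a =>
    have := hall a
    have := hsum a
    omega

theorem ballot_of_coeff_substTwo_ne_zero (hij : i < j) (hM : IsBalanced M) (hM' : IsBalanced M')
    (hle : toLex (rectSums p n M') ≤ toLex (rectSums p n M))
    (hne : coeff (substMono i j a₀ M) (∏ v, substTwo k i j a₀ v ^ M' v) ≠ 0) :
    ∑ a ∈ Finset.Iic a₀, M (Fin.succ a, j) ≤ ∑ a ∈ Finset.Iio a₀, M (Fin.succ a, i) := by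
  classical
  obtain ⟨hother, hsum, h0i, h0j⟩ := compare_of_weights hij hM hM' hle (a₀ := a₀) fun u s h1 h2 => by
    rw [← weight_single_apply, ← weight_single_apply]
    have hi : ∀ a : Fin p, (Pi.single u s : DiagIdx p n → ℤ) (a.succ, i) = 0 := fun a =>
      Pi.single_eq_of_ne (h1 a).symm _
    have h0 : 0 ≤ (Pi.single u s : DiagIdx p n → ℤ) (0, j) := by
      by_cases hu : (0, j) = u
      · subst hu
        simpa using h2
      · rw [Pi.single_eq_of_ne hu]
    exact weight_substMono_le (weightGE_substTwo hij h0 (fun a _ => hi a)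
      fun a _ => by rw [hi a, add_zero]; exact ⟨le_rfl, h0⟩) hne
  have hhigh : ∀ a, a₀ < a → M' (a.succ, i) ≤ M (a.succ, i) := by
    intro a ha
    have h1 := weight_substMono_le (w := Pi.single (0, j) 1 + Pi.single (a.succ, i) (-1))
      (weightGE_substTwo hij ?_ ?_ ?_) hne
    · have h2 : ∀ m : DiagIdx p n →₀ ℕ, Finsupp.weight
          (Pi.single (0, j) 1 + Pi.single (a.succ, i) (-1) : DiagIdx p n → ℤ) m =
            m (0, j) - m (a.succ, i) := by
        intro m
        rw [sub_eq_add_neg, ← mul_neg_one ((m (a.succ, i) : ℕ) : ℤ), ← weight_single_apply,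
          ← mul_one ((m (0, j) : ℕ) : ℤ), ← weight_single_apply, Finsupp.weight_eq_sum,
          Finsupp.weight_eq_sum, Finsupp.weight_eq_sum, ← Finset.sum_add_distrib]
        exact Finset.sum_congr rfl fun _ _ => by rw [Pi.add_apply, smul_add]
      rw [h2, h2, substMono_zero_right hij, substMono_zero_right hij, substMono_succ_left hij,
        substMono_succ_left hij, if_neg ha.not_gt, if_neg ha.not_gt, if_pos ha, if_pos ha] at h1
      have := hsum a
      omega
    · simp [hij.ne']
    · intro a' ha'
      have : a' ≠ a := (ha'.trans ha).ne
      simp [Fin.succ_ne_zero, this]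
    · intro a' _
      simp only [Pi.add_apply, Pi.single_apply, Prod.mk.injEq, Fin.succ_ne_zero, hij.ne, hij.ne',
        and_false, and_true, if_false, if_true, Fin.succ_inj]
      split_ifs <;> simp
  have heq := eq_rows_of_lex_le hij hother hM hM' h0i hle (k := a₀ + 1) fun a ha => hhigh a ha
  have hlow : ∀ a < a₀, M' (a.succ, j) ≤ M (a.succ, i) := by
    intro a ha
    have hw : ∀ m, 0 ≤ Finsupp.weight (Pi.single (a.succ, i) 1 : DiagIdx p n → ℤ) m := fun m => by
      rw [weight_single_apply]
      positivity
    have h1 := WeightGE.prod (s := Finset.univ)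
      (b := fun v => M' v • if v = (a.succ, j) then (1 : ℤ) else 0)
      (l := Finsupp.weight (Pi.single (a.succ, i) 1 : DiagIdx p n → ℤ))
      (fun v _ => WeightGE.pow (k := k) (P := substTwo k i j a₀ v) ?_ (M' v)) _
      (mem_support_iff.2 hne)
    · rw [weight_single_apply, substMono_succ_left hij, if_pos ha] at h1
      simpa using h1
    · split_ifs with hv
      · rw [hv, substTwo, replaceColumns_right hij, Fin.cases_succ, scaleLeft, scaleRight, if_pos ha,
          if_neg ha.not_gt, ← zero_add (1 : ℤ), sub_add_cancel_left]
        exact WeightGE.mul (fun m _ => hw m)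
          (WeightGE.X (by rw [weight_single_apply]; simp)).neg
      · exact fun m _ => hw m
  have h₀ : M' (a₀.succ, j) = 0 := by
    by_contra h
    refine hne ?_
    rw [Finset.prod_eq_zero (Finset.mem_univ (a₀.succ, j)), coeff_zero]
    rw [substTwo, replaceColumns_right hij]
    simp [scaleLeft, scaleRight, h]
  have hsplit : ∀ m : DiagIdx p n →₀ ℕ, ∑ a ∈ Finset.Iic a₀, m (a.succ, j) +
      ∑ a ∈ Finset.Ioi a₀, m (a.succ, j) = ∑ a : Fin p, m (a.succ, j) := by
    intro m
    rw [← Finset.sum_filter_add_sum_filter_not Finset.univ (· ≤ a₀)]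
    congr 2 <;> ext a <;> simp
  have h1 := hsplit M
  have h2 := hsplit M'
  rw [hM j] at h1
  rw [hM' j, h0j] at h2
  have h3 : ∑ a ∈ Finset.Ioi a₀, M' (a.succ, j) = ∑ a ∈ Finset.Ioi a₀, M (a.succ, j) := by
    refine Finset.sum_congr rfl fun a ha => ?_
    have := heq a (Finset.mem_Ioi.1 ha)
    have := hsum a
    omega
  have h4 : ∑ a ∈ Finset.Iic a₀, M (a.succ, j) = ∑ a ∈ Finset.Iic a₀, M' (a.succ, j) := by omega
  rw [h4, ← Finset.Iio_insert, Finset.sum_insert (by simp), h₀, zero_add]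
  exact Finset.sum_le_sum fun a ha => hlow a (Finset.mem_Iio.1 ha)

/-- The ballot condition for a monomial of `symParam k p n f` that is extremal for the
lexicographic order. -/
theorem ballot_of_mem_support (hij : i < j) {f : MvPolynomial (SymIdx p) k}
    (hM : M ∈ (symParam k p n f).support)
    (hmax : ∀ M' ∈ (symParam k p n f).support,
      toLex (rectSums p n M') ≤ toLex (rectSums p n M)) (a₀ : Fin p) :
    ∑ a ∈ Finset.Iic a₀, M (Fin.succ a, j) ≤ ∑ a ∈ Finset.Iio a₀, M (Fin.succ a, i) := by
  by_contra hcon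
  have hbal := fun {m} => isBalanced_of_mem_support (n := n) (f := f) (M := m)
  have h1 := congrArg (coeff (substMono i j a₀ M)) (aeval_substOne_symParam hij f (a₀ := a₀))
  rw [aeval_def, aeval_def, eval₂_eq', eval₂_eq', coeff_sum, coeff_sum, algebraMap_eq,
    Finset.sum_eq_single M, Finset.sum_eq_zero] at h1
  · rw [coeff_C_mul, substMono,
      (IsLead.prod fun v _ => (isLead_substOne hij v (a₀ := a₀) (k := k)).pow (M v)).1, mul_one] at h1
    exact mem_support_iff.1 hM h1
  · intro M' hM'
    rw [coeff_C_mul]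
    by_contra h
    exact hcon (ballot_of_coeff_substTwo_ne_zero hij (hbal hM) (hbal hM') (hmax M' hM')
      (right_ne_zero_of_mul h))
  · intro M' hM' hne
    rw [coeff_C_mul]
    by_contra h
    exact hne (eq_of_coeff_substOne_ne_zero hij (hbal hM) (hbal hM') (hmax M' hM')
      (right_ne_zero_of_mul h))
  · exact fun h => absurd hM h

end Ballot

/-! ### Leading monomials of minors -/

section Minors

open MvPolynomial

variable {p n s : ℕ}

/-- The exponent vector with the entry one at the positions `(ρ r, ι r)`. -/
noncomputable def placeExp (ρ : Fin s → Fin (p + 1)) (ι : Fin s → Fin n) : DiagIdx p n →₀ ℕ :=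
  ∑ r, Finsupp.single (ρ r, ι r) 1

theorem placeExp_comp_perm (ρ : Fin s → Fin (p + 1)) (ι : Fin s → Fin n)
    (π : Equiv.Perm (Fin s)) : placeExp (ρ ∘ π) ι = placeExp ρ (ι ∘ π.symm) := by
  rw [placeExp, placeExp, ← Equiv.sum_comp π.symm]
  simp

theorem rectSums_placeExp (ρ : Fin s → Fin (p + 1)) (ι : Fin s → Fin n)
    (J : Fin n ×ₗ Fin (p + 1)) :
    rectSums p n (placeExp ρ ι) J =
      Finset.card {r | (ρ r).val + (ofLex J).2.val ≤ p ∧ ι r ≤ (ofLex J).1} := by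
  rw [placeExp, map_sum, Finset.sum_apply, Finset.card_filter]
  exact Finset.sum_congr rfl fun r _ => rectSums_single _ _

theorem card_filter_le_of_injective (hs : s ≤ n) {ι : Fin s → Fin n} (hι : Function.Injective ι)
    (l : Fin n) : Finset.card {r | ι r ≤ l} ≤ Finset.card {r | Fin.castLE hs r ≤ l} := by
  rcases lt_or_ge l.val s with h | h
  · calc Finset.card {r | ι r ≤ l} = (Finset.image ι {r | ι r ≤ l}).card :=
          (Finset.card_image_of_injective _ hι).symm
      _ ≤ (Finset.Iic l).card := Finset.card_le_card fun x hx => by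
          obtain ⟨r, hr, rfl⟩ := Finset.mem_image.1 hx
          exact Finset.mem_Iic.2 (Finset.mem_filter.1 hr).2
      _ = (Finset.Iic (⟨l.val, h⟩ : Fin s)).card := by simp
      _ = _ := congrArg _ (by ext r; simp [Fin.le_def])
  · refine Finset.card_le_card fun r _ => Finset.mem_filter.2 ⟨Finset.mem_univ _, ?_⟩
    rw [Fin.le_def, Fin.val_castLE]
    omega

theorem rectSums_placeExp_le (hs : s ≤ n) {ρ : Fin s → Fin (p + 1)} (hρ : Monotone ρ)
    {ι : Fin s → Fin n} (hι : Function.Injective ι) :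
    rectSums p n (placeExp ρ ι) ≤ rectSums p n (placeExp ρ (Fin.castLE hs)) := by
  intro J
  rw [rectSums_placeExp, rectSums_placeExp]
  by_cases h : ∀ r, Fin.castLE hs r ≤ (ofLex J).1 → (ρ r).val + (ofLex J).2.val ≤ p
  · calc _ ≤ Finset.card {r | ι r ≤ (ofLex J).1} :=
          Finset.card_le_card fun r hr => by
            simp only [Finset.mem_filter, Finset.mem_univ, true_and] at hr ⊢
            exact hr.2
      _ ≤ _ := card_filter_le_of_injective hs hι _
      _ ≤ _ := Finset.card_le_card fun r hr => by
            simp only [Finset.mem_filter, Finset.mem_univ, true_and] at hr ⊢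
            exact ⟨h r hr, hr⟩
  · push Not at h
    obtain ⟨r₀, h1, h2⟩ := h
    refine Finset.card_le_card fun r hr => ?_
    simp only [Finset.mem_filter, Finset.mem_univ, true_and] at hr ⊢
    refine ⟨hr.1, le_trans ?_ h1⟩
    have : r < r₀ := by
      by_contra hlt
      have := Fin.le_def.1 (hρ (not_lt.1 hlt))
      omega
    exact this.le

theorem eq_castLE_of_placeExp_eq (hs : s ≤ n) {ρ : Fin s → Fin (p + 1)}
    (hρ : Function.Injective ρ) {ι : Fin s → Fin n}
    (h : placeExp ρ ι = placeExp ρ (Fin.castLE hs)) : ι = Fin.castLE hs := by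
  classical
  funext r
  have h1 := DFunLike.congr_fun h (ρ r, ι r)
  simp only [placeExp, Finsupp.finsetSum_apply, Finsupp.single_apply, Prod.mk.injEq] at h1
  rw [Finset.sum_eq_single r, Finset.sum_eq_single r] at h1
  · simp only [and_self, if_true, true_and] at h1
    by_contra hne
    rw [if_neg (Ne.symm hne)] at h1
    exact one_ne_zero h1
  · intro r' _ hr'
    rw [if_neg fun h => hr' (hρ h.1)]
  · simp
  · intro r' _ hr'
    rw [if_neg fun h => hr' (hρ h.1)]
  · simp

/-- The exponents of the monomials in the expansion of a minor of `X D Xᵀ`. -/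
noncomputable def minorExp (a b : Fin s → Fin p) (ι : Fin s → Fin n) (π : Equiv.Perm (Fin s)) :
    DiagIdx p n →₀ ℕ :=
  placeExp (fun _ => 0) ι + placeExp (fun r => (a (π r)).succ) ι + placeExp (fun r => (b r).succ) ι

variable {k : Type*} [Field k]

theorem det_sum_mul_mul {T : Type*} [CommRing T] (d : Fin n → T) (x y : Fin s → Fin n → T) :
    Matrix.det (Matrix.of fun i j => ∑ l, d l * x i l * y j l) =
      ∑ z : (Fin s → Fin n) × Equiv.Perm (Fin s) with Function.Injective z.1,
        ((Equiv.Perm.sign z.2 : ℤ) : T) *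
          ((∏ r, d (z.1 r)) * (∏ r, x (z.2 r) (z.1 r)) * ∏ r, y r (z.1 r)) := by
  classical
  rw [Finset.sum_filter, Fintype.sum_prod_type, Matrix.det_apply']
  simp only [Matrix.of_apply, Finset.prod_univ_sum, Fintype.piFinset_univ, Finset.mul_sum]
  rw [Finset.sum_comm]
  refine Finset.sum_congr rfl fun ι _ => ?_
  split_ifs with h
  · refine Finset.sum_congr rfl fun π _ => ?_
    rw [Finset.prod_mul_distrib, Finset.prod_mul_distrib]
  · rw [Function.not_injective_iff] at h
    obtain ⟨r, r', h1, h2⟩ := h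
    have h3 := Matrix.det_zero_of_column_eq (M := Matrix.of fun i j => x i (ι j)) h2
      fun i => by simp [h1]
    rw [Matrix.det_apply'] at h3
    rw [Finset.sum_const_zero, ← mul_zero ((∏ r, d (ι r)) * ∏ r, y r (ι r)), ← h3, Finset.mul_sum]
    refine Finset.sum_congr rfl fun π _ => ?_
    rw [Finset.prod_mul_distrib, Finset.prod_mul_distrib]
    simp only [Matrix.of_apply]
    ring

theorem monomial_minorExp (a b : Fin s → Fin p) (ι : Fin s → Fin n) (π : Equiv.Perm (Fin s))
    (c : k) : monomial (minorExp a b ι π) c =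
      C c * ((∏ r, X (0, ι r)) * (∏ r, X ((a (π r)).succ, ι r)) * ∏ r, X ((b r).succ, ι r)) := by
  have h : ∀ ρ : Fin s → Fin (p + 1), ∏ r, X (ρ r, ι r) = monomial (placeExp ρ ι) (1 : k) :=
    fun ρ => (monomial_sum_one _ _).symm
  rw [h fun _ => 0, h fun r => (a (π r)).succ, h fun r => (b r).succ, monomial_mul, monomial_mul,
    C_mul_monomial, one_mul, one_mul, mul_one, minorExp]

theorem symParam_symMinor (a b : Fin s → Fin p) :
    symParam k p n (symMinor k a b) =
      ∑ z : (Fin s → Fin n) × Equiv.Perm (Fin s) with Function.Injective z.1,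
        monomial (minorExp a b z.1 z.2) ((Equiv.Perm.sign z.2 : ℤ) : k) := by
  rw [symMinor, AlgHom.map_det]
  refine Eq.trans ?_ ((det_sum_mul_mul (fun l => (X (0, l) : MvPolynomial (DiagIdx p n) k))
    (fun i l => X ((a i).succ, l)) fun j l => X ((b j).succ, l)).trans
    (Finset.sum_congr rfl fun z _ => ?_))
  · congr 1
    ext1 i j
    simp [symParam_symVar]
  · rw [monomial_minorExp, map_intCast]

theorem isLead_symMinor (hs : s ≤ n) {a b : Fin s → Fin p} (ha : StrictMono a)
    (hb : StrictMono b) :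
    IsLead (rectSums p n) (minorExp a b (Fin.castLE hs) 1) (symParam k p n (symMinor k a b)) := by
  classical
  rw [symParam_symMinor]
  refine IsLead.sum_monomial (i := (Fin.castLE hs, 1)) ?_ (by simp) ?_
  · exact Finset.mem_filter.2 ⟨Finset.mem_univ _, Fin.castLE_injective hs⟩
  · rintro ⟨ι, π⟩ h1 hne
    have hι : Function.Injective ι := (Finset.mem_filter.1 h1).2
    have hιπ : Function.Injective (ι ∘ π.symm) := hι.comp π.symm.injective
    have ha' : StrictMono fun r => (a r).succ := fun x y h => Fin.succ_lt_succ_iff.2 (ha h)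
    have hb' : StrictMono fun r => (b r).succ := fun x y h => Fin.succ_lt_succ_iff.2 (hb h)
    have e1 : placeExp (fun r => (a (π r)).succ) ι =
      placeExp (fun r => (a r).succ) (ι ∘ π.symm) := placeExp_comp_perm (fun r => (a r).succ) ι π
    simp only [minorExp, map_add, e1, Equiv.Perm.one_apply]
    have l1 := rectSums_placeExp_le hs (ρ := fun _ => (0 : Fin (p + 1))) monotone_const hι
    have l2 := rectSums_placeExp_le hs ha'.monotone hιπ
    have l3 := rectSums_placeExp_le hs hb'.monotone hι
    by_cases h3 : placeExp (fun r => (b r).succ) ι = placeExp (fun r => (b r).succ) (Fin.castLE hs)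
    · have h4 := eq_castLE_of_placeExp_eq hs hb'.injective h3
      refine add_lt_add_of_lt_of_le (add_lt_add_of_le_of_lt l1 (l2.lt_of_ne fun h => hne ?_)) l3
      have h5 := eq_castLE_of_placeExp_eq hs ha'.injective (rectSums_injective h)
      rw [h4] at h5
      refine Prod.ext h4 (Equiv.ext fun r => ?_)
      have h6 := congrFun h5 (π r)
      simp only [Function.comp_apply, Equiv.symm_apply_apply] at h6
      exact (Fin.castLE_injective hs h6).symm
    · exact add_lt_add_of_le_of_lt (add_le_add l1 l2)
        (l3.lt_of_ne fun h => h3 (rectSums_injective h))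

end Minors

section Tail

open MvPolynomial

variable {p n s : ℕ}

/-- The sum of the exponents of the diagonal variables from the column `q` on. -/
noncomputable def tailWeight (p n q : ℕ) : (DiagIdx p n →₀ ℕ) →+ ℕ :=
  Finsupp.weight fun v => if v.1 = 0 ∧ q ≤ v.2.val then 1 else 0

theorem tailWeight_minorExp (q : ℕ) (a b : Fin s → Fin p) (ι : Fin s → Fin n)
    (π : Equiv.Perm (Fin s)) :
    tailWeight p n q (minorExp a b ι π) = Finset.card {r | q ≤ (ι r).val} := by
  simp only [minorExp, placeExp, map_add, map_sum, tailWeight, Finsupp.weight_single,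
    Fin.succ_ne_zero, false_and, if_false, Finset.sum_const_zero, add_zero, true_and,
    Finset.card_filter, smul_eq_mul, one_mul]

theorem le_card_filter_of_injective (q : ℕ) {ι : Fin s → Fin n} (hι : Function.Injective ι) :
    s - q ≤ Finset.card {r | q ≤ (ι r).val} := by
  have h1 : Finset.card {r | ¬ q ≤ (ι r).val} ≤ q := by
    rw [← Finset.card_image_of_injective _ (Fin.val_injective.comp hι)]
    conv_rhs => rw [← Finset.card_range q]
    refine Finset.card_le_card fun x hx => ?_
    obtain ⟨r, hr, rfl⟩ := Finset.mem_image.1 hx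
    exact Finset.mem_range.2 (not_le.1 (Finset.mem_filter.1 hr).2)
  have h2 := Finset.card_filter_add_card_filter_not (s := Finset.univ)
    fun r : Fin s => q ≤ (ι r).val
  rw [Finset.card_univ, Fintype.card_fin] at h2
  omega

theorem card_filter_castLE (q : ℕ) (hs : s ≤ n) :
    Finset.card {r | q ≤ (Fin.castLE hs r).val} = s - q := by
  refine le_antisymm ?_ (le_card_filter_of_injective q (Fin.castLE_injective hs))
  rw [← Finset.card_image_of_injective _ Fin.val_injective, ← Nat.card_Ico]
  refine Finset.card_le_card fun x hx => ?_
  obtain ⟨r, hr, rfl⟩ := Finset.mem_image.1 hx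
  exact Finset.mem_Ico.2 ⟨(Finset.mem_filter.1 hr).2, r.isLt⟩

variable {k : Type*} [Field k]

theorem weightGE_symMinor (q : ℕ) (a b : Fin s → Fin p) :
    WeightGE (tailWeight p n q) (s - q) (symParam k p n (symMinor k a b)) := by
  rw [symParam_symMinor]
  refine WeightGE.sum fun z hz m hm => ?_
  rw [Finset.mem_singleton.1 (support_monomial_subset hm), tailWeight_minorExp]
  exact le_card_filter_of_injective q (Finset.mem_filter.1 hz).2

end Tail

/-! ### Products of minors with a given leading monomial -/

section Tableaux

open MvPolynomial

variable {p n : ℕ}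

/-- Minors given by strictly increasing row and column indices. -/
structure StrictMinor (p : ℕ) where
  /-- the size of the minor -/
  size : ℕ
  /-- the row indices -/
  row : Fin size → Fin p
  /-- the column indices -/
  col : Fin size → Fin p
  row_strictMono : StrictMono row
  col_strictMono : StrictMono col

theorem StrictMinor.size_le (x : StrictMinor p) : x.size ≤ p := by
  simpa using Fintype.card_le_of_injective _ x.row_strictMono.injective

/-- The exponent of the leading monomial of a minor. -/
noncomputable def StrictMinor.leadExp (hpn : p ≤ n) (x : StrictMinor p) : DiagIdx p n →₀ ℕ :=
  minorExp x.row x.col (Fin.castLE (x.size_le.trans hpn)) 1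

theorem placeExp_castLE_apply {s : ℕ} (hs : s ≤ n) (ρ : Fin s → Fin (p + 1)) (v : DiagIdx p n) :
    placeExp ρ (Fin.castLE hs) v = if h : v.2.val < s then if ρ ⟨v.2, h⟩ = v.1 then 1 else 0
      else 0 := by
  classical
  rw [placeExp, Finsupp.finsetSum_apply]
  split_ifs with h h'
  · rw [Finset.sum_eq_single ⟨v.2, h⟩]
    · rw [Finsupp.single_apply, if_pos]
      exact Prod.ext h' rfl
    · intro r _ hr
      rw [Finsupp.single_apply, if_neg]
      rintro rfl
      exact hr rfl
    · simp
  · refine Finset.sum_eq_zero fun r _ => ?_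
    rw [Finsupp.single_apply, if_neg]
    rintro rfl
    exact h' rfl
  · refine Finset.sum_eq_zero fun r _ => ?_
    rw [Finsupp.single_apply, if_neg]
    rintro rfl
    exact h r.isLt

theorem StrictMinor.leadExp_zero (hpn : p ≤ n) (x : StrictMinor p) (l : Fin n) :
    x.leadExp hpn (0, l) = if l.val < x.size then 1 else 0 := by
  simp [leadExp, minorExp, placeExp_castLE_apply, Fin.succ_ne_zero]

theorem StrictMinor.leadExp_succ_of_lt (hpn : p ≤ n) (x : StrictMinor p) {l : Fin n}
    (h : l.val < x.size) (a : Fin p) :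
    x.leadExp hpn (a.succ, l) =
      (if x.row ⟨l, h⟩ = a then 1 else 0) + if x.col ⟨l, h⟩ = a then 1 else 0 := by
  simp [leadExp, minorExp, placeExp_castLE_apply, (Fin.succ_ne_zero _).symm, h]

theorem StrictMinor.leadExp_of_le (hpn : p ≤ n) (x : StrictMinor p) {l : Fin n}
    (h : x.size ≤ l.val) (c : Fin (p + 1)) : x.leadExp hpn (c, l) = 0 := by
  simp [leadExp, minorExp, placeExp_castLE_apply, h.not_gt]

/-- The sum of the exponents in the rows `1, …, N` of a column. -/
def colSum (M : DiagIdx p n →₀ ℕ) (l : Fin n) (N : ℕ) : ℕ :=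
  ∑ a : Fin p with a.val < N, M (a.succ, l)

variable {M M' : DiagIdx p n →₀ ℕ}

theorem colSum_zero (l : Fin n) : colSum M l 0 = 0 := by simp [colSum]

theorem colSum_succ (l : Fin n) (a : Fin p) :
    colSum M l (a + 1) = colSum M l a + M (a.succ, l) := by
  classical
  have : (Finset.univ.filter fun a' : Fin p => a'.val < a.val + 1) =
      insert a (Finset.univ.filter fun a' : Fin p => a'.val < a.val) := by
    ext a'
    simp only [Finset.mem_filter, Finset.mem_univ, true_and, Finset.mem_insert, Fin.ext_iff]
    omega
  rw [colSum, this, Finset.sum_insert (by simp), add_comm, colSum]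

theorem colSum_mono (l : Fin n) : Monotone (colSum M l) := fun N N' h =>
  Finset.sum_le_sum_of_subset fun a ha => by
    rw [Finset.mem_filter] at ha ⊢
    exact ⟨ha.1, ha.2.trans_le h⟩

theorem colSum_of_le (l : Fin n) {N : ℕ} (h : p ≤ N) :
    colSum M l N = ∑ a : Fin p, M (a.succ, l) := by
  rw [colSum, Finset.filter_true_of_mem fun a _ => a.isLt.trans_le h]

theorem colSum_add (l : Fin n) (N : ℕ) :
    colSum (M + M') l N = colSum M l N + colSum M' l N := by
  simp [colSum, Finset.sum_add_distrib]

/-- The ballot condition: the columns of the tableau encoded by `M` decrease. -/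
def IsBallot (M : DiagIdx p n →₀ ℕ) : Prop :=
  ∀ i j, i < j → ∀ N < p, colSum M j (N + 1) ≤ colSum M i N

theorem exists_entry {l : Fin n} {c : ℕ} (hc : 1 ≤ c) (h : c ≤ colSum M l p) :
    ∃ e : Fin p, ∀ N, e.val < N ↔ c ≤ colSum M l N := by
  classical
  have hex : ∃ N, c ≤ colSum M l N := ⟨p, h⟩
  have h0 : 0 < Nat.find hex := by
    rw [Nat.find_pos, colSum_zero]
    omega
  have hle : Nat.find hex ≤ p := Nat.find_min' hex h
  refine ⟨⟨Nat.find hex - 1, by omega⟩, fun N => ⟨fun hN => ?_, fun hN => ?_⟩⟩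
  · exact (Nat.find_spec hex).trans (colSum_mono l (by simp only at hN; omega))
  · have := Nat.find_min' hex hN
    simp only
    omega

theorem exists_eq_leadExp_add (hpn : p ≤ n) (hb : IsBalanced M) (hM : IsBallot M) (h0 : M ≠ 0) :
    ∃ (x : StrictMinor p) (M' : DiagIdx p n →₀ ℕ), M = x.leadExp hpn + M' ∧ IsBalanced M' ∧
      IsBallot M' ∧ x.leadExp hpn ≠ 0 := by
  classical
  have hanti : ∀ i j, i < j → M (0, j) ≤ M (0, i) := by
    intro i j hij
    have h1 : colSum M j p ≤ colSum M i p := by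
      rcases p.eq_zero_or_pos with rfl | hp
      · simp [colSum_zero]
      · have := hM i j hij (p - 1) (by omega)
        rw [Nat.sub_add_cancel hp] at this
        exact this.trans (colSum_mono i (by omega))
    rw [colSum_of_le _ le_rfl, colSum_of_le _ le_rfl, hb, hb] at h1
    omega
  have hex : ∃ N, ∀ l : Fin n, N ≤ l.val → M (0, l) = 0 := ⟨n, fun l hl => absurd l.isLt hl.not_gt⟩
  obtain ⟨s, hs1, hs2, hsn⟩ : ∃ s, (∀ l : Fin n, s ≤ l.val → M (0, l) = 0) ∧
      (∀ l : Fin n, l.val < s → 0 < M (0, l)) ∧ s ≤ n := by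
    refine ⟨Nat.find hex, Nat.find_spec hex, fun l hl => Nat.pos_of_ne_zero fun h => ?_,
      Nat.find_min' hex fun l hl => absurd l.isLt hl.not_gt⟩
    refine Nat.find_min hex hl fun l' hl' => ?_
    rcases (Fin.le_def.2 hl').eq_or_lt with rfl | h'
    · exact h
    · have := hanti l l' h'
      omega
  have hcol : ∀ l : Fin n, colSum M l p = 2 * M (0, l) := fun l => by
    rw [colSum_of_le _ le_rfl, hb]
  have hentry : ∀ c, 1 ≤ c → c ≤ 2 → ∃ e : Fin s → Fin p, StrictMono e ∧
      ∀ r N, (e r).val < N ↔ c ≤ colSum M (Fin.castLE hsn r) N := by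
    intro c h1 h2
    have : ∀ r : Fin s, c ≤ colSum M (Fin.castLE hsn r) p := fun r => by
      have := hs2 (Fin.castLE hsn r) r.isLt
      rw [hcol]
      omega
    choose e he using fun r => exists_entry h1 (this r)
    refine ⟨e, fun r r' hr => ?_, he⟩
    rw [Fin.lt_def, he]
    exact ((he r' _).1 (Nat.lt_succ_self _)).trans (hM _ _ hr _ (e r').isLt)
  obtain ⟨e₁, he₁, hN₁⟩ := hentry 1 le_rfl one_le_two
  obtain ⟨e₂, he₂, hN₂⟩ := hentry 2 one_le_two le_rfl
  let x : StrictMinor p := ⟨s, e₁, e₂, he₁, he₂⟩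
  have hzero : ∀ l : Fin n, s ≤ l.val → ∀ c, M (c, l) = 0 := by
    intro l hl c
    refine Fin.cases (hs1 l hl) (fun a => ?_) c
    have h1 := hb l
    rw [hs1 l hl, mul_zero, Finset.sum_eq_zero_iff] at h1
    exact h1 a (Finset.mem_univ a)
  have heq : ∀ e a : Fin p, (if e = a then 1 else 0) =
      (if e.val < a.val + 1 then 1 else 0) - if e.val < a.val then 1 else 0 := by
    intro e a
    simp only [Fin.ext_iff]
    split_ifs <;> omega
  have hle : x.leadExp hpn ≤ M := by
    rintro ⟨c, l⟩
    rcases lt_or_ge l.val s with h | h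
    · refine Fin.cases ?_ (fun a => ?_) c
      · rw [x.leadExp_zero hpn l, if_pos h]
        exact hs2 l h
      · rw [x.leadExp_succ_of_lt hpn h, heq, heq]
        have h1 := colSum_succ (M := M) l a
        simp only [x, hN₁, hN₂, Fin.castLE_mk, Fin.eta]
        split_ifs <;> omega
    · rw [x.leadExp_of_le hpn h]
      exact Nat.zero_le _
  obtain ⟨M', hM'⟩ := exists_add_of_le hle
  have hlead : ∀ l N, N ≤ p → colSum (x.leadExp hpn) l N = min 2 (colSum M l N) := by
    intro l N
    induction N with
    | zero => simp [colSum_zero]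
    | succ N ih =>
      intro hN
      have h1 := ih (by omega)
      have h2 := colSum_succ (M := x.leadExp hpn) l ⟨N, hN⟩
      have h3 := colSum_succ (M := M) l ⟨N, hN⟩
      rw [h2]
      simp only at h2 h3 h1 ⊢
      rw [h1]
      rcases lt_or_ge l.val s with h | h
      · rw [x.leadExp_succ_of_lt hpn h, heq, heq]
        simp only [x, hN₁, hN₂, Fin.castLE_mk, Fin.eta]
        split_ifs <;> omega
      · rw [x.leadExp_of_le hpn h]
        rw [hzero l h] at h3
        omega
  have hrem : ∀ l N, N ≤ p → colSum M' l N = colSum M l N - 2 := by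
    intro l N hN
    have h1 := hlead l N hN
    have h2 := colSum_add (M := x.leadExp hpn) (M' := M') l N
    rw [← hM'] at h2
    omega
  refine ⟨x, M', hM', fun l => ?_, fun i j hij N hN => ?_, fun h => h0 ?_⟩
  · rw [← colSum_of_le l le_rfl, hrem l p le_rfl, hcol]
    have h1 := DFunLike.congr_fun hM' (0, l)
    rw [Finsupp.add_apply, x.leadExp_zero hpn l] at h1
    have h2 := hs1 l
    have h3 : x.size = s := rfl
    split_ifs at h1 <;> omega
  · rw [hrem j _ hN, hrem i _ hN.le]
    exact Nat.sub_le_sub_right (hM i j hij N hN) 2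
  · ext ⟨c, l⟩
    have h1 := DFunLike.congr_fun h (0, l)
    rw [x.leadExp_zero hpn l] at h1
    refine hzero l (le_of_not_gt fun h2 => ?_) c
    rw [if_pos h2] at h1
    exact one_ne_zero h1

/-- A monomial that satisfies the ballot condition is the leading monomial of a product of
minors. -/
theorem exists_eq_sum_leadExp (hpn : p ≤ n) (hb : IsBalanced M) (hM : IsBallot M) :
    ∃ L : List (StrictMinor p), M = (L.map (StrictMinor.leadExp hpn)).sum := by
  induction hd : M.degree using Nat.strong_induction_on generalizing M with
  | _ d ih =>
    by_cases h0 : M = 0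
    · exact ⟨[], by simp [h0]⟩
    · obtain ⟨x, M', h1, h2, h3, h4⟩ := exists_eq_leadExp_add hpn hb hM h0
      obtain ⟨L, hL⟩ := ih M'.degree (by
        rw [← hd, h1, map_add]
        have := Nat.pos_of_ne_zero (mt (Finsupp.degree_eq_zero_iff _).1 h4)
        omega) h2 h3 rfl
      exact ⟨x :: L, by rw [List.map_cons, List.sum_cons, ← hL, h1]⟩

end Tableaux

/-! ### Minors span the polynomials of large tail weight -/

section Straightening

open MvPolynomial

variable {p n : ℕ} {k : Type*} [Field k]

theorem isBallot_of_mem_support {f : MvPolynomial (SymIdx p) k} {M : DiagIdx p n →₀ ℕ}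
    (hM : M ∈ (symParam k p n f).support)
    (hmax : ∀ M' ∈ (symParam k p n f).support,
      toLex (rectSums p n M') ≤ toLex (rectSums p n M)) : IsBallot M := by
  intro i j hij N hN
  have h := ballot_of_mem_support hij hM hmax ⟨N, hN⟩
  have h1 : Finset.Iic (⟨N, hN⟩ : Fin p) = Finset.univ.filter fun a => a.val < N + 1 := by
    ext a
    simp [Fin.le_def]
  have h2 : Finset.Iio (⟨N, hN⟩ : Fin p) = Finset.univ.filter fun a => a.val < N := by
    ext a
    simp [Fin.lt_def]
  rwa [h1, h2] at h

variable (k) in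
/-- The product of a list of minors. -/
noncomputable def minorProd (L : List (StrictMinor p)) : MvPolynomial (SymIdx p) k :=
  (L.map fun x => symMinor k x.row x.col).prod

/-- The sum of the excess sizes of a list of minors. -/
def excess (q : ℕ) (L : List (StrictMinor p)) : ℕ := (L.map fun x => x.size - q).sum

theorem minorProd_cons (x : StrictMinor p) (L : List (StrictMinor p)) :
    minorProd k (x :: L) = symMinor k x.row x.col * minorProd k L := by
  rw [minorProd, List.map_cons, List.prod_cons, minorProd]

theorem excess_cons (q : ℕ) (x : StrictMinor p) (L : List (StrictMinor p)) :
    excess q (x :: L) = (x.size - q) + excess q L := by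
  rw [excess, List.map_cons, List.sum_cons, excess]

/-- The ideal generated by the products of minors with a given total excess. -/
noncomputable def excessIdeal (k : Type*) [Field k] (p q N : ℕ) : Ideal (MvPolynomial (SymIdx p) k) :=
  Ideal.span {f | ∃ L : List (StrictMinor p), N ≤ excess q L ∧ f = minorProd k L}

theorem isLead_minorProd (hpn : p ≤ n) (L : List (StrictMinor p)) :
    IsLead (rectSums p n) (L.map (StrictMinor.leadExp hpn)).sum
      (symParam k p n (minorProd k L)) := by
  induction L with
  | nil => simpa [minorProd] using IsLead.one
  | cons x L ih =>
    rw [minorProd_cons, map_mul, List.map_cons, List.sum_cons]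
    exact (isLead_symMinor _ x.row_strictMono x.col_strictMono).mul ih

theorem tailWeight_sum_leadExp (hpn : p ≤ n) (q : ℕ) (L : List (StrictMinor p)) :
    tailWeight p n q (L.map (StrictMinor.leadExp hpn)).sum = excess q L := by
  induction L with
  | nil => simp [excess]
  | cons x L ih =>
    rw [List.map_cons, List.sum_cons, map_add, ih, excess_cons, StrictMinor.leadExp, tailWeight_minorExp, card_filter_castLE]

theorem weightGE_minorProd (q : ℕ) (L : List (StrictMinor p)) :
    WeightGE (tailWeight p n q) (excess q L) (symParam k p n (minorProd k L)) := by
  induction L with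
  | nil => simpa [minorProd, excess] using WeightGE.one
  | cons x L ih =>
    rw [minorProd_cons, map_mul, excess_cons]
    exact (weightGE_symMinor q x.row x.col).mul ih

theorem exists_reduction (hn : p * p ≤ n) (hpn : p ≤ n) {q N : ℕ} {f : MvPolynomial (SymIdx p) k}
    (hf : WeightGE (tailWeight p n q) N (symParam k p n f)) (h0 : f ≠ 0) :
    ∃ g, f - g ∈ excessIdeal k p q N ∧ WeightGE (tailWeight p n q) N (symParam k p n g) ∧
      ∃ M ∈ (symParam k p n f).support, ∀ m ∈ (symParam k p n g).support,
        toLex (rectSums p n m) < toLex (rectSums p n M) := by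
  classical
  have hne : symParam k p n f ≠ 0 := by
    rwa [Ne, map_eq_zero_iff _ (symParam_injective hn)]
  obtain ⟨M, hM, hmax⟩ := Finset.exists_max_image _ (fun m => toLex (rectSums p n m))
    (support_nonempty.2 hne)
  obtain ⟨L, hL⟩ := exists_eq_sum_leadExp hpn (isBalanced_of_mem_support hM)
    (isBallot_of_mem_support hM hmax)
  have hex : N ≤ excess q L := by
    rw [← tailWeight_sum_leadExp hpn, ← hL]
    exact hf M hM
  have hlead := isLead_minorProd (k := k) hpn L
  rw [← hL] at hlead
  set c := coeff M (symParam k p n f)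
  have hmap : symParam k p n (C c * minorProd k L) = C c * symParam k p n (minorProd k L) := by
    rw [map_mul, ← algebraMap_eq, AlgHom.commutes, algebraMap_eq]
  refine ⟨f - C c * minorProd k L, ?_, ?_, M, hM, fun m hm => ?_⟩
  · rw [sub_sub_cancel]
    exact Ideal.mul_mem_left _ _ (Ideal.subset_span ⟨L, hex, rfl⟩)
  · rw [map_sub, hmap]
    refine hf.sub ?_
    simpa using (WeightGE.C c).mul ((weightGE_minorProd q L).mono hex)
  · rw [map_sub, hmap] at hm
    have hmM : m ≠ M := by
      rintro rfl
      rw [mem_support_iff, coeff_sub, coeff_C_mul, hlead.1, mul_one] at hm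
      exact hm (sub_self c)
    have hle : toLex (rectSums p n m) ≤ toLex (rectSums p n M) := by
      rcases Finset.mem_union.1 (support_sub _ _ _ hm) with h | h
      · exact hmax m h
      · refine Pi.toLex_monotone (hlead.le ?_)
        rw [mem_support_iff, coeff_C_mul] at h
        exact mem_support_iff.2 (right_ne_zero_of_mul h)
    exact hle.lt_of_ne fun h => hmM (rectSums_injective (toLex.injective h))

/-- A polynomial whose image has large tail weight is a combination of products of minors of large
excess. -/
theorem mem_excessIdeal_of_weightGE (hn : p * p ≤ n) {q N : ℕ} {f : MvPolynomial (SymIdx p) k}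
    (hf : WeightGE (tailWeight p n q) N (symParam k p n f)) : f ∈ excessIdeal k p q N := by
  classical
  have hpn : p ≤ n := (Nat.le_mul_self p).trans hn
  let key : MvPolynomial (SymIdx p) k → WithBot (Lex (Fin n ×ₗ Fin (p + 1) → ℕ)) := fun f =>
    (symParam k p n f).support.sup fun m => WithBot.some (toLex (rectSums p n m))
  have hwf : WellFounded fun f g => key f < key g := InvImage.wf key wellFounded_lt
  induction f using hwf.induction with
  | _ f ih =>
    by_cases h0 : f = 0
    · simp [h0]
    · obtain ⟨g, h1, h2, M, hM, h3⟩ := exists_reduction hn hpn hf h0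
      have hlt : key g < key f := by
        refine lt_of_lt_of_le ((Finset.sup_lt_iff (WithBot.bot_lt_coe _)).2 fun m hm =>
          WithBot.coe_lt_coe.2 (h3 m hm)) (Finset.le_sup (f := fun m =>
            WithBot.some (toLex (rectSums p n m))) hM)
      simpa using add_mem h1 (ih g hlt h2)

theorem weightGE_of_mem_excessIdeal {q N : ℕ} {f : MvPolynomial (SymIdx p) k}
    (hf : f ∈ excessIdeal k p q N) : WeightGE (tailWeight p n q) N (symParam k p n f) := by
  refine Submodule.span_induction ?_ ?_ ?_ ?_ hf
  · rintro _ ⟨L, hL, rfl⟩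
    exact (weightGE_minorProd q L).mono hL
  · rw [map_zero]
    exact WeightGE.zero
  · intro x y _ _ hx hy
    simpa using hx.add hy
  · intro a x _ hx
    have h : WeightGE (tailWeight p n q) 0 (symParam k p n a) := fun _ _ => Nat.zero_le _
    simpa using h.mul hx

theorem mem_excessIdeal_iff (hn : p * p ≤ n) {q N : ℕ} {f : MvPolynomial (SymIdx p) k} :
    f ∈ excessIdeal k p q N ↔ WeightGE (tailWeight p n q) N (symParam k p n f) :=
  ⟨weightGE_of_mem_excessIdeal, mem_excessIdeal_of_weightGE hn⟩

end Straightening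

/-! ### The order of vanishing is a valuation -/

section Valuation

open MvPolynomial

variable {V k : Type*} [Field k]

/-- The multiplication of the variables by powers of a new variable. -/
noncomputable def weightScale (w : V → ℕ) :
    MvPolynomial V k →ₐ[k] Polynomial (MvPolynomial V k) :=
  aeval fun v => Polynomial.C (X v) * Polynomial.X ^ w v

theorem weightScale_monomial (w : V → ℕ) (m : V →₀ ℕ) (c : k) :
    weightScale w (monomial m c) =
      Polynomial.C (monomial m c) * Polynomial.X ^ Finsupp.weight w m := by
  rw [weightScale, aeval_monomial, monomial_eq, Finsupp.weight_apply, Finsupp.prod, Finsupp.prod,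
    Finsupp.sum, ← Finset.prod_pow_eq_pow_sum, map_mul, map_prod, mul_assoc,
    ← Finset.prod_mul_distrib]
  congr 1
  refine Finset.prod_congr rfl fun v _ => ?_
  rw [mul_pow, map_pow, ← pow_mul, smul_eq_mul, mul_comm (w v)]

theorem coeff_coeff_weightScale (w : V → ℕ) (P : MvPolynomial V k) (m : V →₀ ℕ) (d : ℕ) :
    coeff m ((weightScale w P).coeff d) = if Finsupp.weight w m = d then coeff m P else 0 := by
  classical
  induction P using MvPolynomial.induction_on' with
  | monomial u a =>
    rw [weightScale_monomial, Polynomial.coeff_C_mul_X_pow, coeff_monomial]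
    by_cases hu : u = m
    · subst hu
      simp [apply_ite (coeff u), eq_comm]
    · simp [apply_ite (coeff m), hu]
  | add P Q hP hQ =>
    rw [map_add, Polynomial.coeff_add, coeff_add, hP, hQ, coeff_add]
    split_ifs <;> simp

theorem weightGE_iff_dvd (w : V → ℕ) (P : MvPolynomial V k) (N : ℕ) :
    WeightGE (Finsupp.weight w) N P ↔ Polynomial.X ^ N ∣ weightScale w P := by
  rw [Polynomial.X_pow_dvd_iff]
  refine ⟨fun h d hd => ?_, fun h m hm => ?_⟩
  · ext m
    rw [coeff_coeff_weightScale, coeff_zero, ite_eq_right_iff]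
    rintro rfl
    by_contra h'
    exact absurd (h m (mem_support_iff.2 h')) hd.not_ge
  · by_contra h'
    have := coeff_coeff_weightScale w P m (Finsupp.weight w m)
    rw [h _ (not_le.1 h'), if_pos rfl] at this
    exact mem_support_iff.1 hm this.symm

theorem WeightGE.of_mul {w : V → ℕ} {P Q : MvPolynomial V k} {N : ℕ}
    (h : WeightGE (Finsupp.weight w) N (P * Q)) (hP : ¬ WeightGE (Finsupp.weight w) 1 P) :
    WeightGE (Finsupp.weight w) N Q := by
  rw [weightGE_iff_dvd] at h hP ⊢
  rw [map_mul] at h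
  rw [pow_one] at hP
  exact Polynomial.prime_X.pow_dvd_of_dvd_mul_left N hP h

end Valuation

/-! ### The ideal of minors and its symbolic powers -/

section MinorIdeal

open MvPolynomial

variable {p : ℕ} {k : Type*} [Field k]

theorem symMinor_mem_genericSymMinors {t : ℕ} {a b : Fin t → Fin p} (ha : Function.Injective a)
    (hb : Function.Injective b) : symMinor k a b ∈ genericSymMinors k p t :=
  ⟨a, b, ha, hb, rfl⟩

/-- The ideal of minors of size `t`. -/
noncomputable abbrev minorIdeal (k : Type*) [Field k] (p t : ℕ) : Ideal (MvPolynomial (SymIdx p) k) :=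
  Ideal.span (genericSymMinors k p t)

/-- The ideal generated by the variables. -/
noncomputable abbrev varIdeal (k : Type*) [Field k] (p : ℕ) : Ideal (MvPolynomial (SymIdx p) k) :=
  Ideal.span (Set.range X)

theorem symMinor_succ_mem {s : ℕ} {J : Ideal (MvPolynomial (SymIdx p) k)}
    (a b : Fin (s + 1) → Fin p)
    (h : ∀ j : Fin (s + 1), symMinor k (a ∘ Fin.succ) (b ∘ j.succAbove) ∈ J) :
    symMinor k a b ∈ varIdeal k p * J := by
  rw [symMinor, Matrix.det_succ_row_zero]
  refine sum_mem fun j _ => ?_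
  rw [mul_assoc]
  refine Ideal.mul_mem_left _ _ (Ideal.mul_mem_mul ?_ (h j))
  exact Ideal.subset_span ⟨_, rfl⟩

theorem minorIdeal_succ_le (s : ℕ) :
    minorIdeal k p (s + 1) ≤ varIdeal k p * minorIdeal k p s := by
  refine Ideal.span_le.2 ?_
  rintro _ ⟨a, b, ha, hb, rfl⟩
  exact symMinor_succ_mem a b fun j => Ideal.subset_span <| symMinor_mem_genericSymMinors
    (ha.comp (Fin.succ_injective _)) (hb.comp j.succAbove_right_injective)

theorem minorIdeal_antitone : Antitone (minorIdeal k p) :=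
  antitone_nat_of_succ_le fun s => (minorIdeal_succ_le s).trans Ideal.mul_le_right

theorem minorProd_mem_of_mem {J : Ideal (MvPolynomial (SymIdx p) k)} {L : List (StrictMinor p)}
    {x : StrictMinor p} (hx : x ∈ L) (h : symMinor k x.row x.col ∈ J) : minorProd k L ∈ J :=
  Ideal.mem_of_dvd _ (List.dvd_prod (List.mem_map_of_mem hx)) h

variable {t : ℕ}

theorem minorIdeal_eq_excessIdeal (ht : 1 ≤ t) :
    minorIdeal k p t = excessIdeal k p (t - 1) 1 := by
  refine le_antisymm (Ideal.span_le.2 ?_) (Ideal.span_le.2 ?_)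
  · rintro _ ⟨a, b, ha, hb, rfl⟩
    refine mem_excessIdeal_of_weightGE (le_refl (p * p)) ?_
    exact (weightGE_symMinor (t - 1) a b).mono (by omega)
  · rintro _ ⟨L, hL, rfl⟩
    have : ∃ x ∈ L, t ≤ x.size := by
      by_contra! h
      have : excess (t - 1) L = 0 := by
        refine List.sum_eq_zero fun y hy => ?_
        obtain ⟨x, hx, rfl⟩ := List.mem_map.1 hy
        have := h x hx
        omega
      omega
    obtain ⟨x, hx, hxt⟩ := this
    exact minorProd_mem_of_mem hx <| minorIdeal_antitone hxt <| Ideal.subset_span <|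
      symMinor_mem_genericSymMinors x.row_strictMono.injective x.col_strictMono.injective

theorem mem_excessIdeal_of_mul_mem {q N : ℕ} {f s : MvPolynomial (SymIdx p) k}
    (hs : s ∉ excessIdeal k p q 1) (h : s * f ∈ excessIdeal k p q N) :
    f ∈ excessIdeal k p q N := by
  rw [mem_excessIdeal_iff (le_refl (p * p))] at hs h ⊢
  rw [map_mul] at h
  exact WeightGE.of_mul h hs

theorem excessIdeal_mul_le (q a b : ℕ) :
    excessIdeal k p q a * excessIdeal k p q b ≤ excessIdeal k p q (a + b) := by
  refine Ideal.mul_le.2 fun f hf g hg => ?_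
  rw [mem_excessIdeal_iff (le_refl (p * p))] at hf hg ⊢
  rw [map_mul]
  exact hf.mul hg

theorem excessIdeal_pow_le (q N : ℕ) : excessIdeal k p q 1 ^ N ≤ excessIdeal k p q N := by
  induction N with
  | zero =>
    intro f _
    rw [mem_excessIdeal_iff (le_refl (p * p))]
    exact fun _ _ => Nat.zero_le _
  | succ N ih =>
    rw [pow_succ]
    exact (Ideal.mul_mono_left ih).trans (excessIdeal_mul_le q N 1)

theorem excessIdeal_one_isPrime (q : ℕ) : (excessIdeal k p q 1).IsPrime := by
  refine Ideal.isPrime_iff.2 ⟨fun h => ?_, fun {x y} h => ?_⟩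
  · have h1 := weightGE_of_mem_excessIdeal (n := p * p) ((Ideal.eq_top_iff_one _).1 h) 0
    simp at h1
  · by_contra! h'
    exact h'.2 (mem_excessIdeal_of_mul_mem h'.1 h)

theorem minorIdeal_isPrime (ht : 1 ≤ t) : (minorIdeal k p t).IsPrime := by
  rw [minorIdeal_eq_excessIdeal ht]
  exact excessIdeal_one_isPrime _

theorem mem_symbolicPower_iff {R : Type*} [CommRing R] [IsNoetherianRing R] {I : Ideal R}
    [I.IsPrime] {N : ℕ} {f : R} : f ∈ symbolicPower I N ↔ ∃ s, s ∉ I ∧ s * f ∈ I ^ N := by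
  have h := associatedPrimes.eq_singleton_of_isPrimary (Ideal.IsPrime.isPrimary ‹I.IsPrime›)
  rw [Ideal.IsPrime.radical ‹_›] at h
  change (∀ P ∈ associatedPrimes R (R ⧸ I), _) ↔ _
  simp [h]

theorem symbolicPower_minorIdeal_le (ht : 1 ≤ t) (N : ℕ) :
    symbolicPower (minorIdeal k p t) N ≤ excessIdeal k p (t - 1) N := by
  have := minorIdeal_isPrime (k := k) (p := p) ht
  intro f hf
  obtain ⟨s, hs, hsf⟩ := mem_symbolicPower_iff.1 hf
  rw [minorIdeal_eq_excessIdeal ht] at hs hsf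
  exact mem_excessIdeal_of_mul_mem hs (excessIdeal_pow_le _ _ hsf)

theorem symbolicPower_mul_le {R : Type*} [CommRing R] (I : Ideal R) (a b : ℕ) :
    symbolicPower I a * symbolicPower I b ≤ symbolicPower I (a + b) := by
  refine Ideal.mul_le.2 fun f hf g hg P hP => ?_
  obtain ⟨s, hs, hsf⟩ := hf P hP
  obtain ⟨s', hs', hsg⟩ := hg P hP
  refine ⟨s * s', fun h => (hP.1.mem_or_mem h).elim hs hs', ?_⟩
  rw [mul_mul_mul_comm, pow_add]
  exact Ideal.mul_mem_mul hsf hsg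

end MinorIdeal

/-! ### Sylvester's identity -/

section Sylvester

variable {m n R : Type*} [Fintype m] [Fintype n] [DecidableEq m] [DecidableEq n] [CommRing R]

/-- The matrix obtained by adding one row and one column to the top left block. -/
def borderMatrix (M : Matrix (m ⊕ n) (m ⊕ n) R) (i j : n) : Matrix (m ⊕ Fin 1) (m ⊕ Fin 1) R :=
  M.submatrix (Sum.map id fun _ => i) (Sum.map id fun _ => j)

theorem det_borderMatrix_of_isUnit (M : Matrix (m ⊕ n) (m ⊕ n) R)
    (h : IsUnit M.toBlocks₁₁.det) :
    M.toBlocks₁₁.det * (Matrix.of fun i j => (borderMatrix M i j).det).det =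
      M.toBlocks₁₁.det ^ Fintype.card n * M.det := by
  have : Invertible M.toBlocks₁₁ := M.toBlocks₁₁.invertibleOfIsUnitDet h
  have h1 : ∀ i j, (borderMatrix M i j).det = M.toBlocks₁₁.det *
      (M.toBlocks₂₂ - M.toBlocks₂₁ * ⅟M.toBlocks₁₁ * M.toBlocks₁₂) i j := by
    intro i j
    rw [← Matrix.fromBlocks_toBlocks (borderMatrix M i j)]
    change (Matrix.fromBlocks M.toBlocks₁₁ _ _ _).det = _
    rw [Matrix.det_fromBlocks₁₁, Matrix.det_fin_one]
    rfl
  have h2 : (Matrix.of fun i j => (borderMatrix M i j).det) = M.toBlocks₁₁.det •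
      (M.toBlocks₂₂ - M.toBlocks₂₁ * ⅟M.toBlocks₁₁ * M.toBlocks₁₂) := by
    ext i j
    rw [Matrix.of_apply, h1, Matrix.smul_apply, smul_eq_mul]
  have h3 : M.det = M.toBlocks₁₁.det *
      (M.toBlocks₂₂ - M.toBlocks₂₁ * ⅟M.toBlocks₁₁ * M.toBlocks₁₂).det := by
    conv_lhs => rw [← Matrix.fromBlocks_toBlocks M]
    rw [Matrix.det_fromBlocks₁₁]
  rw [h2, Matrix.det_smul, h3, mul_left_comm]

theorem det_borderMatrix [IsDomain R] (M : Matrix (m ⊕ n) (m ⊕ n) R)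
    (h : M.toBlocks₁₁.det ≠ 0) :
    M.toBlocks₁₁.det * (Matrix.of fun i j => (borderMatrix M i j).det).det =
      M.toBlocks₁₁.det ^ Fintype.card n * M.det := by
  let φ := algebraMap R (FractionRing R)
  have hφ : Function.Injective φ := IsFractionRing.injective R (FractionRing R)
  have h1 : (φ.mapMatrix M).toBlocks₁₁.det = φ M.toBlocks₁₁.det := (φ.map_det _).symm
  have h2 := det_borderMatrix_of_isUnit (φ.mapMatrix M)
    (h1 ▸ ((map_ne_zero_iff φ hφ).2 h).isUnit)
  have h3 : (Matrix.of fun i j => (borderMatrix (φ.mapMatrix M) i j).det) =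
      φ.mapMatrix (Matrix.of fun i j => (borderMatrix M i j).det) := by
    ext i j
    exact (φ.map_det _).symm
  apply hφ
  rwa [h1, h3, ← φ.map_det, ← φ.map_det, ← map_pow, ← map_mul, ← map_mul] at h2

theorem det_mem_pow {I : Ideal R} {M : Matrix n n R} (h : ∀ i j, M i j ∈ I) :
    M.det ∈ I ^ Fintype.card n := by
  rw [Matrix.det_apply]
  refine sum_mem fun σ _ => ?_
  rw [Units.smul_def]
  refine zsmul_mem ?_ _
  rw [← Finset.card_univ, ← Finset.prod_const]
  exact Ideal.prod_mem_prod fun i _ => h _ i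

end Sylvester

section MinorIdeal

open MvPolynomial

variable {p : ℕ} {k : Type*} [Field k]

theorem symMinor_notMem_excessIdeal {q : ℕ} {a b : Fin q → Fin p} (ha : StrictMono a)
    (hb : StrictMono b) : symMinor k a b ∉ excessIdeal k p q 1 := by
  intro h
  have hq : q ≤ p := by simpa using Fintype.card_le_of_injective _ ha.injective
  have h1 := weightGE_of_mem_excessIdeal (n := p) h
  have h2 := isLead_symMinor (k := k) hq ha hb
  have h3 := h1 _ (by rw [mem_support_iff, h2.1]; exact one_ne_zero)
  rw [tailWeight_minorExp, card_filter_castLE, Nat.sub_self] at h3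
  exact absurd h3 (by omega)

theorem symMinor_mem_symbolicPower {q j : ℕ} {a b : Fin (q + j) → Fin p} (ha : StrictMono a)
    (hb : StrictMono b) : symMinor k a b ∈ symbolicPower (minorIdeal k p (q + 1)) j := by
  have := minorIdeal_isPrime (k := k) (p := p) (Nat.le_add_left 1 q)
  let M : Matrix (Fin q ⊕ Fin j) (Fin q ⊕ Fin j) (MvPolynomial (SymIdx p) k) :=
    Matrix.of fun x y => symVar k (a (finSumFinEquiv x)) (b (finSumFinEquiv y))
  have hdet : M.det = symMinor k a b := Matrix.det_submatrix_equiv_self finSumFinEquiv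
    (Matrix.of fun x y => symVar k (a x) (b y))
  have hA : M.toBlocks₁₁.det ∉ minorIdeal k p (q + 1) := by
    rw [minorIdeal_eq_excessIdeal (Nat.le_add_left 1 q), Nat.add_sub_cancel]
    exact symMinor_notMem_excessIdeal (ha.comp (Fin.strictMono_castAdd j))
      (hb.comp (Fin.strictMono_castAdd j))
  have hE : ∀ i l, (borderMatrix M i l).det ∈ minorIdeal k p (q + 1) := by
    intro i l
    have hinj : ∀ r : Fin j, Function.Injective
        (finSumFinEquiv ∘ Sum.map id (fun _ : Fin 1 => r) ∘ finSumFinEquiv.symm :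
          Fin (q + 1) → Fin (q + j)) := fun r =>
      finSumFinEquiv.injective.comp ((Sum.map_injective.2
        ⟨Function.injective_id, Function.injective_of_subsingleton _⟩).comp
          finSumFinEquiv.symm.injective)
    rw [← Matrix.det_submatrix_equiv_self finSumFinEquiv.symm]
    exact Ideal.subset_span <| symMinor_mem_genericSymMinors
      (ha.injective.comp (hinj i)) (hb.injective.comp (hinj l))
  refine mem_symbolicPower_iff.2
    ⟨M.toBlocks₁₁.det ^ j, fun h => hA (‹Ideal.IsPrime _›.mem_of_pow_mem _ h), ?_⟩
  have h1 := det_borderMatrix M fun h => hA (h ▸ zero_mem _)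
  rw [Fintype.card_fin, hdet] at h1
  rw [← h1]
  refine Ideal.mul_mem_left _ _ ?_
  simpa using det_mem_pow (M := Matrix.of fun i l => (borderMatrix M i l).det) hE

end MinorIdeal

/-! ### The containment -/

section Containment

open MvPolynomial

theorem symbolicPower_antitone {R : Type*} [CommRing R] (I : Ideal R) :
    Antitone (symbolicPower I) := by
  intro a b hab f hf P hP
  obtain ⟨s, hs, hsf⟩ := hf P hP
  exact ⟨s, hs, Ideal.pow_le_pow_right hab hsf⟩

theorem mem_symbolicPower_zero {R : Type*} [CommRing R] (I : Ideal R) (f : R) :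
    f ∈ symbolicPower I 0 := fun _ hP =>
  ⟨1, fun h => hP.1.ne_top ((Ideal.eq_top_iff_one _).2 h), by simp⟩

variable {p : ℕ} {k : Type*} [Field k] {q : ℕ}

theorem minorProd_mem_symbolicPower (L : List (StrictMinor p)) :
    minorProd k L ∈ symbolicPower (minorIdeal k p (q + 1)) (excess q L) := by
  induction L with
  | nil => exact mem_symbolicPower_zero _ _
  | cons x L ih =>
    rw [minorProd_cons, excess_cons]
    refine symbolicPower_mul_le _ _ _ (Ideal.mul_mem_mul ?_ ih)
    obtain ⟨s, a, b, ha, hb⟩ := x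
    simp only
    rcases le_total s q with h | h
    · rw [Nat.sub_eq_zero_of_le h]
      exact mem_symbolicPower_zero _ _
    · obtain ⟨j, rfl⟩ := Nat.exists_eq_add_of_le h
      rw [Nat.add_sub_cancel_left]
      exact symMinor_mem_symbolicPower ha hb

theorem excessIdeal_le_symbolicPower (m : ℕ) :
    excessIdeal k p q m ≤ symbolicPower (minorIdeal k p (q + 1)) m := by
  refine Ideal.span_le.2 ?_
  rintro _ ⟨L, hL, rfl⟩
  exact symbolicPower_antitone _ hL (minorProd_mem_symbolicPower L)

theorem minorProd_mem_excessIdeal (L : List (StrictMinor p)) :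
    minorProd k L ∈ excessIdeal k p q (excess q L) :=
  Ideal.subset_span ⟨L, le_rfl, rfl⟩

theorem excessIdeal_antitone : Antitone (excessIdeal k p q) := fun _ _ h =>
  Ideal.span_mono fun _ ⟨L, hL, hf⟩ => ⟨L, h.trans hL, hf⟩

theorem symMinor_mem_varIdeal_mul {s : ℕ} {a b : Fin (s + 1) → Fin p} (ha : StrictMono a)
    (hb : StrictMono b) : symMinor k a b ∈ varIdeal k p * excessIdeal k p q (s - q) := by
  refine symMinor_succ_mem a b fun j => ?_
  have := minorProd_mem_excessIdeal (k := k) (q := q) [⟨s, a ∘ Fin.succ, b ∘ j.succAbove,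
    ha.comp (Fin.strictMono_succ), hb.comp j.strictMono_succAbove⟩]
  simpa [minorProd, excess] using this

theorem minorProd_mem_varIdeal_mul {L : List (StrictMinor p)} {N : ℕ} (hL : N + 1 ≤ excess q L) :
    minorProd k L ∈ varIdeal k p * excessIdeal k p q N := by
  induction L generalizing N with
  | nil => simp [excess] at hL
  | cons x L ih =>
    rw [excess_cons] at hL
    rw [minorProd_cons]
    obtain ⟨s, a, b, ha, hb⟩ := x
    simp only at hL ⊢
    rcases le_or_gt s q with h | h
    · exact Ideal.mul_mem_left _ _ (ih (by omega))
    · obtain ⟨s, rfl⟩ := Nat.exists_eq_add_one_of_ne_zero (Nat.ne_zero_of_lt h)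
      have h1 := Ideal.mul_mem_mul (symMinor_mem_varIdeal_mul (k := k) (q := q) ha hb)
        (minorProd_mem_excessIdeal (k := k) (q := q) L)
      rw [mul_assoc] at h1
      refine Ideal.mul_mono_right ((excessIdeal_mul_le _ _ _).trans
        (excessIdeal_antitone ?_)) h1
      omega

theorem excessIdeal_add_le (N d : ℕ) :
    excessIdeal k p q (N + d) ≤ varIdeal k p ^ d * excessIdeal k p q N := by
  induction d with
  | zero => simp
  | succ d ih =>
    refine (Ideal.span_le.2 ?_ : excessIdeal k p q (N + d + 1) ≤
      varIdeal k p * excessIdeal k p q (N + d)).trans ?_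
    · rintro _ ⟨L, hL, rfl⟩
      exact minorProd_mem_varIdeal_mul hL
    · rw [pow_succ', mul_assoc]
      exact Ideal.mul_mono_right ih

/-- A list of large excess can be cut so that the excess of the first part slightly exceeds a given
number. -/
theorem exists_split {L : List (StrictMinor p)} {m : ℕ} (hm : m ≤ excess q L) :
    ∃ L₁ L₂, L = L₁ ++ L₂ ∧ m ≤ excess q L₁ ∧ excess q L₁ ≤ m + (p - q - 1) := by
  induction L generalizing m with
  | nil => exact ⟨[], [], rfl, hm, by simp [excess]⟩
  | cons x L ih =>
    rw [excess_cons] at hm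
    rcases m.eq_zero_or_pos with rfl | h0
    · exact ⟨[], x :: L, rfl, Nat.zero_le _, by simp [excess]⟩
    · obtain ⟨L₁, L₂, h1, h2, h3⟩ := ih (m := m - (x.size - q)) (by omega)
      have := x.size_le
      rcases le_or_gt m (x.size - q) with h | h
      · exact ⟨[x], L, rfl, by simpa [excess] using h, by simp [excess]; omega⟩
      · exact ⟨x :: L₁, L₂, by rw [h1, List.cons_append], by rw [excess_cons]; omega,
          by rw [excess_cons]; omega⟩

theorem minorProd_mem_mul_pow {m r : ℕ} {L : List (StrictMinor p)}
    (hL : r * m + (r - 1) * (p - q - 1) ≤ excess q L) :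
    minorProd k L ∈ varIdeal k p ^ (excess q L - r * m) *
      symbolicPower (minorIdeal k p (q + 1)) m ^ r := by
  have hone : ∀ (d : ℕ) (L : List (StrictMinor p)), d ≤ excess q L →
      minorProd k L ∈ varIdeal k p ^ (excess q L - d) * excessIdeal k p q d := fun d L h =>
    excessIdeal_add_le d (excess q L - d) <| by
      rw [Nat.add_sub_cancel' h]
      exact minorProd_mem_excessIdeal L
  induction r generalizing L with
  | zero =>
    rw [pow_zero, Ideal.one_eq_top, Ideal.mul_top, zero_mul]
    exact Ideal.mul_le_left (hone 0 L (Nat.zero_le _))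
  | succ r ih =>
    rw [Nat.add_sub_cancel, add_one_mul] at hL
    obtain ⟨L₁, L₂, rfl, h1, h2⟩ := exists_split (q := q) (L := L) (m := m) (by omega)
    have hex : excess q (L₁ ++ L₂) = excess q L₁ + excess q L₂ := by simp [excess]
    have hprod : minorProd k (L₁ ++ L₂) = minorProd k L₁ * minorProd k L₂ := by simp [minorProd]
    have h3 : r * m + (r - 1) * (p - q - 1) ≤ excess q L₂ := by
      rcases r with - | r
      · simp
      · rw [hex, add_one_mul r (p - q - 1)] at hL
        rw [Nat.add_sub_cancel]
        omega
    have h4 := Ideal.mul_mem_mul (Ideal.mul_mono_right (excessIdeal_le_symbolicPower m)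
      (hone m L₁ h1)) (ih h3)
    rw [mul_mul_mul_comm, ← pow_add, ← pow_succ', ← hprod] at h4
    have h5 : excess q L₁ - m + (excess q L₂ - r * m) =
        excess q (L₁ ++ L₂) - (r + 1) * m := by
      rw [hex, add_one_mul]
      omega
    rwa [h5] at h4

theorem excessIdeal_le_mul_pow {m r d : ℕ} (hd : (r - 1) * (p - q - 1) ≤ d) :
    excessIdeal k p q (r * m + d) ≤
      varIdeal k p ^ d * symbolicPower (minorIdeal k p (q + 1)) m ^ r := by
  refine Ideal.span_le.2 ?_
  rintro _ ⟨L, hL, rfl⟩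
  exact Ideal.mul_mono_left (Ideal.pow_le_pow_right (by omega))
    (minorProd_mem_mul_pow (q := q) (m := m) (r := r) (L := L) (by omega))

end Containment
/-- **Remark `rmk.gensym` (stronger containment).** Let `I = I_t(Y)` be the ideal of
`t`-minors of a generic symmetric `p×p` matrix of indeterminates, of height
`h = (p−t+1)(p−t+2)/2`.  Then for all `m, r, c ≥ 1`,
`I^{(r(m+h−1)−h+c)} ⊆ 𝔪^{(r−1)(h−1)+c−1} (I^{(m)})^r`. -/
theorem stmt_17 {k : Type*} [Field k] (p t : ℕ) (ht : 1 ≤ t) (htp : t ≤ p)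
    (h : ℕ) (hh : h = (p - t + 1) * (p - t + 2) / 2) :
    ∀ m r c : ℕ, 1 ≤ m → 1 ≤ r → 1 ≤ c →
      symbolicPower (Ideal.span (genericSymMinors k p t)) (r * (m + h - 1) - h + c) ≤
        (Ideal.span (Set.range (MvPolynomial.X : {ij : Fin p × Fin p // ij.1 ≤ ij.2} →
            MvPolynomial {ij : Fin p × Fin p // ij.1 ≤ ij.2} k))) ^ ((r - 1) * (h - 1) + c - 1) *
          (symbolicPower (Ideal.span (genericSymMinors k p t)) m) ^ r := by
  intro m r c hm hr hc
  have hle : p - t + 1 ≤ h := by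
    rw [hh, Nat.le_div_iff_mul_le two_pos]
    exact Nat.mul_le_mul_left _ (by omega)
  obtain ⟨q, rfl⟩ := Nat.exists_eq_add_of_le' ht
  obtain ⟨r, rfl⟩ := Nat.exists_eq_add_of_le' hr
  obtain ⟨c, rfl⟩ := Nat.exists_eq_add_of_le' hc
  obtain ⟨h, rfl⟩ := Nat.exists_eq_add_of_le' ((Nat.le_add_left 1 _).trans hle)
  have h1 : (r + 1) * (m + (h + 1) - 1) - (h + 1) + (c + 1) = (r + 1) * m + (r * h + c) := by
    rw [show m + (h + 1) - 1 = m + h by omega, mul_add, add_one_mul r h, add_one_mul r m]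
    omega
  have h2 : (r + 1 - 1) * (h + 1 - 1) + (c + 1) - 1 = r * h + c := by
    simp only [Nat.add_sub_cancel, ← add_assoc]
  rw [h1, h2]
  refine (symbolicPower_minorIdeal_le ht _).trans (excessIdeal_le_mul_pow ?_)
  exact (Nat.mul_le_mul_left _ (by omega)).trans (Nat.le_add_right _ _)
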